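/- arXiv:1910.11409 — 2 statements merged into one kernel-verified Lean document; each statement's English description precedes it below -/
import Mathlib

section
/- Let d ≥ 3 be an integer, let p, q ∈ [1,∞], and let r > d/(d-2) satisfy 1/p + 1/q ≥ 1/r. Then the bilinear discrete spherical maximal operator T* is bounded from l^p(ℤ^d) × l^q(ℤ^d) to l^r(ℤ^d): there exists a constant C = C(d,p,q,r) such that for all f ∈ l^p(ℤ^d) and g ∈ l^q(ℤ^d), ‖T*(f,g)‖_{l^r(ℤ^d)} ≤ C ‖f‖_{l^p(ℤ^d)} ‖g‖_{l^q(ℤ^d)}. -/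
open scoped ENNReal NNReal BigOperators

noncomputable section

/-- `ℤ^d` -/
abbrev V (d : ℕ) := Fin d → ℤ

/-- The sphere `{(u,v) ∈ ℤ^d × ℤ^d : |u|² + |v|² = λ}`. -/
def sph (d lam : ℕ) : Set (V d × V d) :=
  {uv | (∑ i, uv.1 i ^ 2) + (∑ i, uv.2 i ^ 2) = (lam : ℤ)}

/-- `N(λ)`, the number of lattice points on the sphere of radius `λ^{1/2}` in `ℝ^{2d}`. -/
def Ncount (d lam : ℕ) : ℕ := Nat.card (sph d lam)

/-- The bilinear discrete spherical average `T_λ(f,g)(x)`. -/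
def avg (d lam : ℕ) (f g : V d → ℂ) (x : V d) : ℂ :=
  (Ncount d lam : ℂ)⁻¹ *
    ∑' uv : sph d lam, f (x - (uv : V d × V d).1) * g (x - (uv : V d × V d).2)

/-- The bilinear discrete spherical maximal function
`T*(f,g)(x) = sup_{λ ∈ ℕ, N(λ) > 0} |T_λ(f,g)(x)|`. -/
def maxOp (d : ℕ) (f g : V d → ℂ) (x : V d) : ℝ≥0∞ :=
  ⨆ (lam : ℕ) (_ : 0 < Ncount d lam), (‖avg d lam f g x‖₊ : ℝ≥0∞)

/-- The `l^p(ℤ^d)` norm of a complex-valued function. -/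
def lpNorm (d : ℕ) (p : ℝ) (f : V d → ℂ) : ℝ≥0∞ :=
  (∑' x : V d, (‖f x‖₊ : ℝ≥0∞) ^ p) ^ (1 / p)

/-- The `l^p(ℤ^d)` norm of an `ℝ≥0∞`-valued function. -/
def lpNormE (d : ℕ) (p : ℝ) (F : V d → ℝ≥0∞) : ℝ≥0∞ :=
  (∑' x : V d, F x ^ p) ^ (1 / p)

/-- The `l^∞(ℤ^d)` norm. -/
def linftyNorm (d : ℕ) (f : V d → ℂ) : ℝ≥0∞ :=
  ⨆ x : V d, (‖f x‖₊ : ℝ≥0∞)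


/-- The `l^p(ℤ^d)` norm for an extended-real exponent `p ∈ [1,∞]`. -/
def lpNormC (d : ℕ) (p : ℝ≥0∞) (f : V d → ℂ) : ℝ≥0∞ :=
  if p = ∞ then linftyNorm d f else lpNorm d p.toReal f

/-- A geometric sum of additive characters is controlled by the distance of the frequency to `ℤ`. -/
lemma norm_sum_exp_mul_dist_le (θ : ℝ) (a b : ℤ) :
    ‖∑ j ∈ Finset.Ico a b, Complex.exp (2 * Real.pi * Complex.I * (j * θ))‖ * |θ - round θ|
      ≤ 1 / 2 := by
  rcases le_total b a with hba | hab
  · simp [Finset.Ico_eq_empty_of_le hba]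
  set z : ℂ := Complex.exp (2 * Real.pi * Complex.I * θ) with hz
  have hterm : ∀ j : ℤ, Complex.exp (2 * Real.pi * Complex.I * (j * θ)) = z ^ j := by
    intro j
    rw [hz, ← Complex.exp_int_mul]
    congr 1; ring
  have hz0 : z ≠ 0 := Complex.exp_ne_zero _
  have hz1 : ∀ j : ℤ, ‖z ^ j‖ = 1 := by
    intro j
    rw [← hterm, Complex.norm_exp]; simp
  have htel : ∀ n : ℕ, (∑ j ∈ Finset.Ico a (a + n), z ^ j) * (z - 1) = z ^ (a + n) - z ^ a := by
    intro n
    induction n with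
    | zero => simp
    | succ n ih =>
      have : Finset.Ico a (a + (n + 1 : ℕ)) = insert (a + n : ℤ) (Finset.Ico a (a + n)) := by
        ext x; simp; omega
      rw [this, Finset.sum_insert (by simp), add_mul, ih]
      push_cast
      rw [← add_assoc, zpow_add_one₀ hz0]; ring
  obtain ⟨n, rfl⟩ : ∃ n : ℕ, b = a + n := ⟨(b - a).toNat, by omega⟩
  have h1 : ‖∑ j ∈ Finset.Ico a (a + n), z ^ j‖ * ‖z - 1‖ ≤ 2 := by
    rw [← norm_mul, htel]
    calc _ ≤ ‖z ^ (a + n : ℤ)‖ + ‖z ^ a‖ := norm_sub_le _ _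
      _ = 2 := by rw [hz1, hz1]; norm_num
  have h2 : 4 * |θ - round θ| ≤ ‖z - 1‖ := by
    have : z = Complex.exp (Complex.I * ((2 * Real.pi * (θ - round θ) : ℝ) : ℂ)) := by
      rw [hz, Complex.exp_eq_exp_iff_exists_int]
      exact ⟨round θ, by push_cast; ring⟩
    rw [this, Complex.norm_exp_I_mul_ofReal_sub_one]
    have hr := abs_sub_round θ
    have := Real.mul_abs_le_abs_sin (x := Real.pi * (θ - round θ)) (by
      rw [abs_mul, abs_of_pos Real.pi_pos]; nlinarith [Real.pi_pos])
    rw [abs_mul, abs_of_pos Real.pi_pos] at this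
    have h3 : 2 / Real.pi * (Real.pi * |θ - round θ|) = 2 * |θ - round θ| := by
      field_simp
    rw [h3] at this
    rw [norm_mul, show 2 * Real.pi * (θ - round θ) / 2 = Real.pi * (θ - round θ) by ring]
    simp only [Real.norm_eq_abs]
    norm_num
    linarith
  simp_rw [hterm]
  nlinarith [norm_nonneg (∑ j ∈ Finset.Ico a (a + n), z ^ j), abs_nonneg (θ - round θ)]

lemma sum_range_inv_sqrt_le (K : ℕ) :
    ∑ k ∈ Finset.range K, 1 / √((k : ℝ) + 1) ≤ 2 * √K := by
  induction K with
  | zero => simp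
  | succ K ih =>
    rw [Finset.sum_range_succ]
    push_cast
    have h1 : 0 < √((K : ℝ) + 1) := Real.sqrt_pos.2 (by positivity)
    have h2 := Real.sqrt_nonneg (K : ℝ)
    have h3 := Real.sq_sqrt (show (0 : ℝ) ≤ K by positivity)
    have h4 := Real.sq_sqrt (show (0 : ℝ) ≤ (K : ℝ) + 1 by positivity)
    have : 1 / √((K : ℝ) + 1) ≤ 2 * √((K : ℝ) + 1) - 2 * √(K : ℝ) := by
      rw [div_le_iff₀ h1]
      nlinarith [sq_nonneg (√((K : ℝ) + 1) - √(K : ℝ))]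
    linarith

/-- Contribution of the multiples of the denominator. -/
lemma sum_multiples_le {Y q : ℕ} (hY : 0 < Y) (hq : 0 < q) (a : ℤ) {θ : ℝ}
    (hθ : |θ - a / q| ≤ 1 / (q * (8 * Y))) (T : ℕ → ℝ) (hT0 : ∀ n, 0 ≤ T n)
    (hT : ∀ n, T n ≤ 2 * Y) (hTd : ∀ n : ℕ, T n * |n * θ - round (n * θ)| ≤ 1 / 2) :
    ∑ k ∈ Finset.range (4 * Y / q), T (q * (k + 1)) ≤
      8 * ((Y : ℝ) ^ 2 / q) * (1 / √(max 1 ((Y : ℝ) ^ 2 * |θ - a / q|))) := by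
  set β := θ - a / q with hβ
  have hYr : (0 : ℝ) < Y := by exact_mod_cast hY
  have hqr : (1 : ℝ) ≤ q := by exact_mod_cast hq
  have hK : ((4 * Y / q : ℕ) : ℝ) ≤ 4 * Y / q := by
    simpa using (Nat.cast_div_le (α := ℝ) (m := 4 * Y) (n := q))
  have hb1 : ∑ k ∈ Finset.range (4 * Y / q), T (q * (k + 1)) ≤ 8 * ((Y : ℝ) ^ 2 / q) := by
    calc _ ≤ ∑ k ∈ Finset.range (4 * Y / q), (2 * Y : ℝ) := Finset.sum_le_sum fun k _ => hT _
      _ = ((4 * Y / q : ℕ) : ℝ) * (2 * Y) := by simp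
      _ ≤ (4 * Y / q) * (2 * Y) := by gcongr
      _ = _ := by ring
  rcases le_total ((Y : ℝ) ^ 2 * |β|) 1 with h1 | h1
  · rw [max_eq_left h1]; simpa using hb1
  rw [max_eq_right h1]
  have hβ0 : 0 < |β| := by
    rcases (abs_nonneg β).eq_or_lt with h | h
    · rw [← h] at h1; norm_num at h1
    · exact h
  have hterm : ∀ k ∈ Finset.range (4 * Y / q),
      T (q * (k + 1)) ≤ √(Y / (q * |β|)) * (1 / √((k : ℝ) + 1)) := by
    intro k hk
    have hk' : ((k : ℝ) + 1) * q ≤ 4 * Y := by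
      have : (k + 1) * q ≤ 4 * Y :=
        (Nat.mul_le_mul_right q (Finset.mem_range.1 hk)).trans (Nat.div_mul_le_self _ _)
      exact_mod_cast this
    have hsmall : |((k : ℝ) + 1) * q * β| ≤ 1 / 2 := by
      rw [abs_mul, abs_of_pos (by positivity)]
      calc ((k : ℝ) + 1) * q * |β| ≤ 4 * Y * (1 / (q * (8 * Y))) := by gcongr
        _ = 1 / (2 * q) := by field_simp; norm_num
        _ ≤ 1 / 2 := by
          apply one_div_le_one_div_of_le <;> linarith
    have hdist : ((k : ℝ) + 1) * q * |β| ≤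
        |((q * (k + 1) : ℕ) : ℝ) * θ - round (((q * (k + 1) : ℕ) : ℝ) * θ)| := by
      set m := round (((q * (k + 1) : ℕ) : ℝ) * θ)
      have e : ((q * (k + 1) : ℕ) : ℝ) * θ - m
          = ((k : ℝ) + 1) * q * β - ((m - (k + 1) * a : ℤ) : ℝ) := by
        rw [hβ]; push_cast; field_simp; ring
      rw [e]
      generalize (m - (k + 1) * a : ℤ) = z
      have e2 : ((k : ℝ) + 1) * q * |β| = |((k : ℝ) + 1) * q * β| := by
        rw [abs_mul _ β, abs_of_pos (by positivity : (0 : ℝ) < ((k : ℝ) + 1) * q)]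
      rw [e2]
      rcases eq_or_ne z 0 with rfl | hz
      · simp
      · have h1 : (1 : ℝ) ≤ |(z : ℝ)| := by exact_mod_cast Int.one_le_abs hz
        have h2 := abs_sub_abs_le_abs_sub (z : ℝ) (((k : ℝ) + 1) * q * β)
        rw [abs_sub_comm] at h2
        linarith
    have hTq : T (q * (k + 1)) * (((k : ℝ) + 1) * q * |β|) ≤ 1 / 2 :=
      (mul_le_mul_of_nonneg_left hdist (hT0 _)).trans (hTd _)
    have hc : 0 < ((k : ℝ) + 1) * q * |β| := by positivity
    rw [mul_one_div, ← Real.sqrt_div (by positivity)]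
    apply Real.le_sqrt_of_sq_le
    rw [div_div, le_div_iff₀ (by positivity)]
    calc T (q * (k + 1)) ^ 2 * (q * |β| * (k + 1))
        = T (q * (k + 1)) * (T (q * (k + 1)) * (((k : ℝ) + 1) * q * |β|)) := by ring
      _ ≤ (2 * Y) * (1 / 2) := by
        apply mul_le_mul (hT _) hTq _ (by positivity)
        exact mul_nonneg (hT0 _) hc.le
      _ = Y := by ring
  calc _ ≤ ∑ k ∈ Finset.range (4 * Y / q), √(Y / (q * |β|)) * (1 / √((k : ℝ) + 1)) :=
        Finset.sum_le_sum hterm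
    _ = √(Y / (q * |β|)) * ∑ k ∈ Finset.range (4 * Y / q), 1 / √((k : ℝ) + 1) := by
        rw [Finset.mul_sum]
    _ ≤ √(Y / (q * |β|)) * (2 * √(4 * Y / q)) := by
        gcongr
        exact (sum_range_inv_sqrt_le _).trans (by gcongr)
    _ = 2 * √(4 * (Y ^ 2 / q) ^ 2 / (Y ^ 2 * |β|)) := by
        rw [mul_left_comm, ← Real.sqrt_mul (by positivity)]
        congr 2
        field_simp
    _ = 2 * (2 * (Y ^ 2 / q) / √(Y ^ 2 * |β|)) := by
        rw [Real.sqrt_div (by positivity),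
          show 4 * ((Y : ℝ) ^ 2 / q) ^ 2 = (2 * (Y ^ 2 / q)) ^ 2 by ring,
          Real.sqrt_sq (by positivity)]
    _ ≤ _ := by
        have : 0 ≤ (Y : ℝ) ^ 2 / q / √(Y ^ 2 * |β|) := by positivity
        have e1 : 2 * (2 * ((Y : ℝ) ^ 2 / q) / √(Y ^ 2 * |β|)) =
          4 * ((Y : ℝ) ^ 2 / q / √(Y ^ 2 * |β|)) := by ring
        rw [e1, mul_one_div, mul_div_assoc]
        linarith

/-- Contribution of the integers that are not multiples of the denominator. -/
lemma sum_nonmultiples_le {Y q : ℕ} (hY : 0 < Y) (hq : 0 < q) (hqY : q ≤ 8 * Y) (a : ℤ)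
    (haq : IsCoprime a (q : ℤ)) {θ : ℝ}
    (hθ : |θ - a / q| ≤ 1 / (q * (8 * Y))) (T : ℕ → ℝ) (hT0 : ∀ n, 0 ≤ T n)
    (hTd : ∀ n : ℕ, T n * |n * θ - round (n * θ)| ≤ 1 / 2) :
    ∑ n ∈ (Finset.Icc 1 (4 * Y)).filter (fun n => ¬ q ∣ n), T n ≤
      24 * Y * (harmonic q : ℝ) := by
  have hYr : (0 : ℝ) < Y := by exact_mod_cast hY
  have hqr : (1 : ℝ) ≤ q := by exact_mod_cast hq
  set φ : ℕ → ℕ := fun n => (a * n % q).toNat with hφ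
  have hφc : ∀ n, ((φ n : ℕ) : ℤ) = a * n % q := fun n =>
    Int.toNat_of_nonneg (Int.emod_nonneg _ (by exact_mod_cast hq.ne'))
  have hφlt : ∀ n, φ n < q := fun n => by
    have := Int.emod_lt_of_pos (a * n) (show (0 : ℤ) < q by exact_mod_cast hq)
    rw [← hφc] at this; exact_mod_cast this
  have hφ0 : ∀ n, ¬ q ∣ n → φ n ≠ 0 := by
    intro n hn h0
    have h1 : (q : ℤ) ∣ a * n := by
      apply Int.dvd_of_emod_eq_zero; rw [← hφc, h0]; rfl
    have := haq.symm.dvd_of_dvd_mul_left h1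
    exact hn (by exact_mod_cast this)
  set g : ℕ → ℝ := fun l => if l = 0 then 0 else q / l + q / (q - l : ℕ) with hg
  have hg0 : ∀ l, 0 ≤ g l := by
    intro l; simp only [hg]; split_ifs <;> positivity
  have hpt : ∀ n ∈ (Finset.Icc 1 (4 * Y)).filter (fun n => ¬ q ∣ n), T n ≤ g (φ n) := by
    intro n hn
    simp only [Finset.mem_filter, Finset.mem_Icc] at hn
    obtain ⟨⟨hn1, hn2⟩, hnq⟩ := hn
    have hl0 := hφ0 n hnq
    have hlq := hφlt n
    have hc := hφc n
    set l := φ n with hl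
    obtain ⟨t, ht⟩ : ∃ t : ℤ, a * n = q * t + l := ⟨a * n / q, by
      rw [hc]; exact (Int.mul_ediv_add_emod _ _).symm⟩
    have hmain : ∀ m : ℤ, 1 / (2 * (q / l + q / (q - l : ℕ))) ≤ |(n : ℝ) * θ - m| := by
      intro m
      have hn2r : (n : ℝ) ≤ 4 * Y := by exact_mod_cast hn2
      have hsmall : |n * (θ - a / q)| ≤ 1 / (2 * q) := by
        rw [abs_mul, Nat.abs_cast]
        calc (n : ℝ) * |θ - a / q| ≤ 4 * Y * (1 / (q * (8 * Y))) := by gcongr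
          _ = _ := by field_simp; norm_num
      have htr : (a : ℝ) * n = q * t + l := by exact_mod_cast ht
      have hlr : (1 : ℝ) ≤ l := by exact_mod_cast Nat.one_le_iff_ne_zero.2 hl0
      have hlqr : (1 : ℝ) ≤ (q - l : ℕ) := by exact_mod_cast (by omega : 1 ≤ q - l)
      have hql : ((q - l : ℕ) : ℝ) = q - l := by push_cast [hlq.le]; ring
      have hbig : min (l : ℝ) ((q - l : ℕ) : ℝ) ≤ |(a : ℝ) * n - q * m| := by
        have : min (l : ℤ) ((q - l : ℕ) : ℤ) ≤ |a * n - q * m| := by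
          rw [ht, show (q : ℤ) * t + l - q * m = q * (t - m) + l by ring]
          rcases lt_trichotomy (t - m) 0 with h | h | h
          · rw [abs_of_nonpos (by nlinarith)]
            apply (min_le_right _ _).trans
            push_cast [hlq.le]; nlinarith
          · rw [h]; simp
          · apply (min_le_left _ _).trans
            rw [abs_of_nonneg (by positivity)]
            have : 0 ≤ (q : ℤ) * (t - m) := by positivity
            linarith
        exact_mod_cast this
      set μ := min (l : ℝ) ((q - l : ℕ) : ℝ) with hμ
      have hμ1 : 1 ≤ μ := le_min hlr hlqr
      have h1 : μ / (2 * q) ≤ |(n : ℝ) * θ - m| := by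
        have e : (n : ℝ) * θ - m = (a * n - q * m) / q + n * (θ - a / q) := by
          field_simp; ring
        have h2 : |((a : ℝ) * n - q * m) / q| - |n * (θ - a / q)| ≤ |(n : ℝ) * θ - m| := by
          rw [e]
          have := abs_sub_abs_le_abs_sub (((a : ℝ) * n - q * m) / q) (-(n * (θ - a / q)))
          rwa [abs_neg, sub_neg_eq_add] at this
        have h3 : μ / q ≤ |((a : ℝ) * n - q * m) / q| := by
          rw [abs_div, Nat.abs_cast]; gcongr
        have h4 : 1 / (2 * (q : ℝ)) ≤ μ / (2 * q) := by gcongr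
        have h5 : μ / q = μ / (2 * q) + μ / (2 * q) := by field_simp; norm_num
        linarith
      refine le_trans ?_ h1
      rw [div_le_div_iff₀ (by positivity) (by positivity)]
      rcases min_choice (l : ℝ) ((q - l : ℕ) : ℝ) with h | h
      · rw [hμ, h]
        have e1 : (l : ℝ) * (2 * (q / l + q / (q - l : ℕ))) =
            2 * q + 2 * (l * (q / (q - l : ℕ))) := by
          field_simp
        have : 0 ≤ (l : ℝ) * (q / (q - l : ℕ)) := by positivity
        rw [e1]; linarith
      · rw [hμ, h]
        have e1 : ((q - l : ℕ) : ℝ) * (2 * (q / l + q / (q - l : ℕ)))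
            = 2 * q + 2 * ((q - l : ℕ) * (q / l)) := by
          field_simp; ring
        have : 0 ≤ ((q - l : ℕ) : ℝ) * (q / l) := by positivity
        rw [e1]; linarith
    have h1 := hmain (round ((n : ℝ) * θ))
    have h2 := (mul_le_mul_of_nonneg_left h1 (hT0 n)).trans (hTd n)
    simp only [hg, hl0, if_false]
    have hpos : (0 : ℝ) < q / l + q / (q - l : ℕ) := by
      have : (0 : ℝ) < l := by exact_mod_cast Nat.pos_of_ne_zero hl0
      positivity
    rw [mul_one_div, div_le_iff₀ (by positivity)] at h2
    linarith
  have hperiod : ∑ i ∈ Finset.range q, g (φ i) = ∑ l ∈ Finset.range q, g l := by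
    have hinj : Set.InjOn φ (Finset.range q) := by
      intro i hi j hj hij
      simp only [Finset.coe_range, Set.mem_Iio] at hi hj
      have h1 : a * i % q = a * j % q := by rw [← hφc, ← hφc, hij]
      have h2 : (q : ℤ) ∣ a * (i - j) := by
        have := Int.ModEq.dvd (show a * (j : ℤ) ≡ a * i [ZMOD q] from h1.symm)
        rwa [← mul_sub] at this
      have h3 := haq.symm.dvd_of_dvd_mul_left h2
      have h4 := Int.eq_zero_of_abs_lt_dvd h3 (by rw [abs_lt]; omega)
      omega
    rw [← Finset.sum_image (f := g) hinj]
    congr 1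
    apply Finset.eq_of_subset_of_card_le
    · intro x hx
      obtain ⟨i, -, rfl⟩ := Finset.mem_image.1 hx
      exact Finset.mem_range.2 (hφlt i)
    · rw [Finset.card_image_of_injOn hinj]
  have hgsum : ∑ l ∈ Finset.range q, g l ≤ 2 * q * (harmonic q : ℝ) := by
    have hh : (harmonic q : ℝ) = ∑ i ∈ Finset.range q, 1 / ((i : ℝ) + 1) := by
      simp [harmonic]
    obtain ⟨p, rfl⟩ : ∃ p, q = p + 1 := ⟨q - 1, by omega⟩
    rw [Finset.sum_range_succ']
    have h1 : ∑ k ∈ Finset.range p, ((p + 1 : ℕ) : ℝ) / ((k + 1 : ℕ) : ℝ) =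
        (p + 1 : ℕ) * ∑ i ∈ Finset.range p, 1 / ((i : ℝ) + 1) := by
      rw [Finset.mul_sum]; refine Finset.sum_congr rfl fun k _ => ?_; push_cast; ring
    have h2 : ∑ k ∈ Finset.range p, ((p + 1 : ℕ) : ℝ) / ((p + 1 - (k + 1) : ℕ) : ℝ) =
        (p + 1 : ℕ) * ∑ i ∈ Finset.range p, 1 / ((i : ℝ) + 1) := by
      rw [← h1, ← Finset.sum_range_reflect]
      refine Finset.sum_congr rfl fun k hk => ?_
      have := Finset.mem_range.1 hk
      congr 2; omega
    have h3 : ∑ k ∈ Finset.range p, g (k + 1) =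
        2 * ((p + 1 : ℕ) * ∑ i ∈ Finset.range p, 1 / ((i : ℝ) + 1)) := by
      simp only [hg, Nat.succ_ne_zero, if_false]
      rw [Finset.sum_add_distrib, h1, h2]; ring
    have h4 : ∑ i ∈ Finset.range p, 1 / ((i : ℝ) + 1) ≤ (harmonic (p + 1) : ℝ) := by
      rw [hh, Finset.sum_range_succ]
      have : (0 : ℝ) ≤ 1 / ((p : ℝ) + 1) := by positivity
      linarith
    rw [h3]
    simp only [hg, if_true, add_zero]
    have h5 : (0 : ℝ) ≤ ((p + 1 : ℕ) : ℝ) := by positivity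
    nlinarith
  have hblocks : ∀ K : ℕ, ∑ n ∈ Finset.range (q * K), g (φ n) =
      K * ∑ l ∈ Finset.range q, g l := by
    intro K
    induction K with
    | zero => simp
    | succ K ih =>
      rw [Nat.mul_succ, Finset.sum_range_add, ih, ← hperiod]
      have : ∀ i, φ (q * K + i) = φ i := by
        intro i; simp only [hφ]; push_cast
        rw [mul_add, show a * ((q : ℤ) * K) = q * (a * K) by ring, Int.mul_add_emod_self_left]
      simp_rw [this]; push_cast; ring
  set K := 4 * Y / q + 1 with hKdef
  have hsub : (Finset.Icc 1 (4 * Y)).filter (fun n => ¬ q ∣ n) ⊆ Finset.range (q * K) := by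
    intro n hn
    simp only [Finset.mem_filter, Finset.mem_Icc] at hn
    rw [Finset.mem_range]
    have : 4 * Y < q * K := Nat.lt_mul_div_succ (4 * Y) hq
    omega
  have hK : (K : ℝ) ≤ 4 * Y / q + 1 := by
    rw [hKdef]; push_cast
    have : ((4 * Y / q : ℕ) : ℝ) ≤ 4 * Y / q := by
      simpa using (Nat.cast_div_le (α := ℝ) (m := 4 * Y) (n := q))
    linarith
  have hH : (0 : ℝ) ≤ harmonic q := by
    have : (0 : ℚ) ≤ harmonic q := by unfold harmonic; positivity
    exact_mod_cast this
  have hqYr : (q : ℝ) ≤ 8 * Y := by exact_mod_cast hqY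
  calc _ ≤ ∑ n ∈ (Finset.Icc 1 (4 * Y)).filter (fun n => ¬ q ∣ n), g (φ n) :=
        Finset.sum_le_sum hpt
    _ ≤ ∑ n ∈ Finset.range (q * K), g (φ n) :=
        Finset.sum_le_sum_of_subset_of_nonneg hsub fun _ _ _ => hg0 _
    _ = K * ∑ l ∈ Finset.range q, g l := hblocks K
    _ ≤ (4 * Y / q + 1) * (2 * q * (harmonic q : ℝ)) := by
        gcongr
    _ = (8 * Y + 2 * q) * (harmonic q : ℝ) := by field_simp; ring
    _ ≤ 24 * Y * (harmonic q : ℝ) := by gcongr; linarith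

/-- The quadratic Weyl sum over `|j| < Y`. -/
def weylSum (Y : ℕ) (θ : ℝ) : ℂ :=
  ∑ j ∈ Finset.Ioo (-(Y : ℤ)) Y, Complex.exp (2 * Real.pi * Complex.I * ((j ^ 2 : ℤ) * θ))

/-- The majorant `min (2Y, 1 / (2‖nθ‖))` for the differenced Weyl sum. -/
def weylMajorant (Y : ℕ) (θ : ℝ) (n : ℕ) : ℝ :=
  if |n * θ - round (n * θ)| = 0 then 2 * Y else min (2 * Y) (1 / (2 * |n * θ - round (n * θ)|))

lemma weylMajorant_nonneg (Y : ℕ) (θ : ℝ) (n : ℕ) : 0 ≤ weylMajorant Y θ n := by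
  unfold weylMajorant; split_ifs <;> positivity

lemma weylMajorant_le (Y : ℕ) (θ : ℝ) (n : ℕ) : weylMajorant Y θ n ≤ 2 * Y := by
  unfold weylMajorant; split_ifs
  · exact le_rfl
  · exact min_le_left _ _

lemma weylMajorant_mul_dist_le (Y : ℕ) (θ : ℝ) (n : ℕ) :
    weylMajorant Y θ n * |n * θ - round (n * θ)| ≤ 1 / 2 := by
  unfold weylMajorant; split_ifs with h
  · rw [h]; norm_num
  · have h0 : 0 < |n * θ - round (n * θ)| := lt_of_le_of_ne (abs_nonneg _) (Ne.symm h)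
    calc _ ≤ (1 / (2 * |n * θ - round (n * θ)|)) * |n * θ - round (n * θ)| := by
          gcongr; exact min_le_right _ _
      _ = 1 / 2 := by field_simp

lemma le_weylMajorant {Y : ℕ} {θ : ℝ} {n : ℕ} {x : ℝ} (h1 : x ≤ 2 * Y)
    (h2 : x * |n * θ - round (n * θ)| ≤ 1 / 2) : x ≤ weylMajorant Y θ n := by
  unfold weylMajorant; split_ifs with h
  · exact h1
  · have h0 : 0 < |n * θ - round (n * θ)| := lt_of_le_of_ne (abs_nonneg _) (Ne.symm h)
    refine le_min h1 ?_
    rw [le_div_iff₀ (by positivity)]; linarith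

lemma sum_Ioo_natAbs_le (N : ℕ) (f : ℕ → ℝ) (hf : ∀ n, 0 ≤ f n) :
    ∑ h ∈ Finset.Ioo (-(N : ℤ)) N, f h.natAbs ≤ f 0 + 2 * ∑ n ∈ Finset.Icc 1 N, f n := by
  classical
  have hsub : Finset.Ioo (-(N : ℤ)) N ⊆
      {0} ∪ ((Finset.Icc 1 N).image (fun n : ℕ => (n : ℤ)) ∪
        (Finset.Icc 1 N).image (fun n : ℕ => -(n : ℤ))) := by
    intro h hh
    rw [Finset.mem_Ioo] at hh
    simp only [Finset.mem_union, Finset.mem_singleton, Finset.mem_image, Finset.mem_Icc]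
    rcases lt_trichotomy h 0 with h0 | h0 | h0
    · exact Or.inr (Or.inr ⟨h.natAbs, by omega, by omega⟩)
    · exact Or.inl h0
    · exact Or.inr (Or.inl ⟨h.natAbs, by omega, by omega⟩)
  have hu : ∀ s t : Finset ℤ, ∑ h ∈ s ∪ t, f h.natAbs ≤
      ∑ h ∈ s, f h.natAbs + ∑ h ∈ t, f h.natAbs := by
    intro s t
    rw [← Finset.sum_union_inter]
    exact le_add_of_nonneg_right (Finset.sum_nonneg fun _ _ => hf _)
  calc _ ≤ _ := Finset.sum_le_sum_of_subset_of_nonneg hsub fun _ _ _ => hf _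
    _ ≤ _ := (hu _ _).trans (add_le_add le_rfl (hu _ _))
    _ = _ := by
      rw [Finset.sum_image (by intro a _ b _ h; simpa using h),
        Finset.sum_image (by intro a _ b _ h; simpa using h)]
      simp; ring

/-- Weyl differencing. -/
lemma norm_weylSum_sq_le {Y : ℕ} (hY : 0 < Y) (θ : ℝ) :
    ‖weylSum Y θ‖ ^ 2 ≤ 2 * Y + 2 * ∑ n ∈ Finset.Icc 1 (4 * Y), weylMajorant Y θ n := by
  set I := Finset.Ioo (-(Y : ℤ)) Y with hI
  set e : ℤ → ℂ := fun n => Complex.exp (2 * Real.pi * Complex.I * (n * θ)) with he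
  have headd : ∀ m n, e (m + n) = e m * e n := by
    intro m n; simp only [he]; rw [← Complex.exp_add]; congr 1; push_cast; ring
  have henorm : ∀ n, ‖e n‖ = 1 := by
    intro n; simp only [he]; rw [Complex.norm_exp]; simp
  have heconj : ∀ n, (starRingEnd ℂ) (e n) = e (-n) := by
    intro n; simp only [he]; rw [← Complex.exp_conj]; congr 1
    simp [Complex.conj_ofNat]
  have hsq : ((‖weylSum Y θ‖ ^ 2 : ℝ) : ℂ) =
      ∑ x ∈ I ×ˢ I, e (x.1 ^ 2 - x.2 ^ 2) := by
    have : weylSum Y θ = ∑ j ∈ I, e (j ^ 2) := rfl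
    rw [this]
    push_cast
    rw [← Complex.mul_conj', map_sum, Finset.sum_mul_sum, Finset.sum_product]
    refine Finset.sum_congr rfl fun j _ => Finset.sum_congr rfl fun k _ => ?_
    rw [heconj, ← headd]; rfl
  set H := Finset.Ioo (-((2 * Y : ℕ) : ℤ)) (2 * Y : ℕ) with hH
  have hfib : ∑ x ∈ I ×ˢ I, e (x.1 ^ 2 - x.2 ^ 2) =
      ∑ h ∈ H, ∑ x ∈ (I ×ˢ I).filter (fun x => x.1 - x.2 = h), e (x.1 ^ 2 - x.2 ^ 2) := by
    rw [Finset.sum_fiberwise_of_maps_to]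
    intro x hx
    simp only [hI, Finset.mem_product, Finset.mem_Ioo] at hx
    simp only [hH, Finset.mem_Ioo]
    push_cast; omega
  have hinner : ∀ h ∈ H,
      ‖∑ x ∈ (I ×ˢ I).filter (fun x => x.1 - x.2 = h), e (x.1 ^ 2 - x.2 ^ 2)‖ ≤
        weylMajorant Y θ (2 * h.natAbs) := by
    intro h _
    set A := max (-(Y : ℤ) + 1) (-Y - h + 1) with hA
    set B := min (Y : ℤ) (Y - h) with hB
    have hrew : ∑ x ∈ (I ×ˢ I).filter (fun x => x.1 - x.2 = h), e (x.1 ^ 2 - x.2 ^ 2) =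
        e (h ^ 2) * ∑ k ∈ Finset.Ico A B,
          Complex.exp (2 * Real.pi * Complex.I * (k * ((2 * h : ℤ) * θ : ℝ))) := by
      rw [Finset.mul_sum]
      refine Finset.sum_nbij' (fun x => x.2) (fun k => (k + h, k)) ?_ ?_ ?_ ?_ ?_
      · intro x hx
        simp only [hI, Finset.mem_filter, Finset.mem_product, Finset.mem_Ioo] at hx
        simp only [Finset.mem_Ico]; omega
      · intro k hk
        simp only [Finset.mem_Ico] at hk
        simp only [hI, Finset.mem_filter, Finset.mem_product, Finset.mem_Ioo]; omega
      · intro x hx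
        simp only [Finset.mem_filter] at hx
        ext <;> simp; omega
      · intro k _; rfl
      · intro x hx
        simp only [Finset.mem_filter] at hx
        have : Complex.exp (2 * Real.pi * Complex.I * (x.2 * ((2 * h : ℤ) * θ : ℝ))) =
            e (2 * h * x.2) := by
          simp only [he]; congr 1; push_cast; ring
        rw [this, ← headd]; congr 1
        have : x.1 = x.2 + h := by omega
        rw [this]; ring
    rw [hrew, norm_mul, henorm, one_mul]
    refine le_weylMajorant ?_ ?_
    · refine (norm_sum_le _ _).trans ?_
      have : ∀ k ∈ Finset.Ico A B,
          ‖Complex.exp (2 * Real.pi * Complex.I * (k * ((2 * h : ℤ) * θ : ℝ)))‖ = 1 := by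
        intro k _; rw [Complex.norm_exp]; simp
      rw [Finset.sum_congr rfl this]
      simp only [Finset.sum_const, Int.card_Ico, nsmul_eq_mul, mul_one]
      have : (B - A).toNat ≤ 2 * Y := by omega
      exact_mod_cast this
    · refine le_trans ?_ (norm_sum_exp_mul_dist_le (((2 * h : ℤ) : ℝ) * θ) A B)
      refine mul_le_mul_of_nonneg_left ?_ (norm_nonneg _)
      obtain ⟨m, rfl | rfl⟩ := Int.eq_nat_or_neg h
      · simp
      · refine (round_le _ (-round (((2 * -(m : ℤ) : ℤ) : ℝ) * θ))).trans (le_of_eq ?_)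
        rw [← abs_neg]; congr 1; simp; ring
  have h1 : ‖weylSum Y θ‖ ^ 2 ≤ ∑ h ∈ H, weylMajorant Y θ (2 * h.natAbs) := by
    have : ‖weylSum Y θ‖ ^ 2 = ‖((‖weylSum Y θ‖ ^ 2 : ℝ) : ℂ)‖ := by
      rw [Complex.norm_real, Real.norm_of_nonneg (by positivity)]
    rw [this, hsq, hfib]
    exact (norm_sum_le _ _).trans (Finset.sum_le_sum hinner)
  have h2 := sum_Ioo_natAbs_le (2 * Y) (fun n => weylMajorant Y θ (2 * n))
    fun n => weylMajorant_nonneg _ _ _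
  have h3 : ∑ n ∈ Finset.Icc 1 (2 * Y), weylMajorant Y θ (2 * n) ≤
      ∑ n ∈ Finset.Icc 1 (4 * Y), weylMajorant Y θ n := by
    rw [← Finset.sum_image (g := fun n => 2 * n) (f := fun n => weylMajorant Y θ n)
      (by intro a _ b _ h; simpa using h)]
    refine Finset.sum_le_sum_of_subset_of_nonneg ?_ fun _ _ _ => weylMajorant_nonneg _ _ _
    intro n hn
    obtain ⟨m, hm, rfl⟩ := Finset.mem_image.1 hn
    rw [Finset.mem_Icc] at *; omega
  have h4 := weylMajorant_le Y θ 0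
  simp only [mul_zero] at h2
  linarith

/-- Major-arc bound for the Weyl sum, with an error that is negligible in the moments used later. -/
lemma norm_weylSum_sq_le_major {Y : ℕ} (hY : 0 < Y) {θ : ℝ} (h0 : 0 ≤ θ) (h1 : θ < 1) :
    ∃ q ∈ Finset.Icc 1 (8 * Y), ∃ a ∈ Finset.range (q + 1),
      ‖weylSum Y θ‖ ^ 2 ≤ 1000 * max
        ((Y : ℝ) ^ 2 / q * (1 / √(max 1 ((Y : ℝ) ^ 2 * |θ - a / q|))))
            ((Y : ℝ) ^ (11 / 10 : ℝ)) := by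
  have hYr : (1 : ℝ) ≤ Y := by exact_mod_cast hY
  obtain ⟨x, hx, hxd⟩ := Real.exists_rat_abs_sub_le_and_den_le θ (n := 8 * Y) (by omega)
  set q := x.den with hq
  have hq0 : 0 < q := x.den_pos
  have hqr : (1 : ℝ) ≤ q := by exact_mod_cast hq0
  have hxe : (x : ℝ) = x.num / q := by exact_mod_cast (Rat.num_div_den x).symm
  rw [hxe] at hx
  have hx' : |θ - x.num / q| * (q * (8 * Y + 1)) ≤ 1 := by
    rw [le_div_iff₀ (by positivity)] at hx
    push_cast at hx; linarith
  have hxq : |θ * q - x.num| * (8 * Y + 1) ≤ 1 := by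
    have : |θ * q - x.num| = |θ - x.num / q| * q := by
      rw [← abs_of_pos (show (0 : ℝ) < q by positivity), ← abs_mul,
        abs_of_pos (show (0 : ℝ) < q by positivity)]
      congr 1; field_simp
    rw [this]; linarith
  have hlt : |θ * q - x.num| < 1 := by nlinarith [abs_nonneg (θ * q - x.num)]
  rw [abs_lt] at hlt
  have hn0 : 0 ≤ x.num := by
    have : (-1 : ℝ) < x.num := by nlinarith
    have : (-1 : ℤ) < x.num := by exact_mod_cast this
    omega
  have hn1 : x.num ≤ q := by
    have : (x.num : ℝ) < q + 1 := by nlinarith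
    have : x.num < q + 1 := by exact_mod_cast this
    omega
  refine ⟨q, Finset.mem_Icc.2 ⟨hq0, hxd⟩, x.num.toNat, Finset.mem_range.2 (by omega), ?_⟩
  have hac : ((x.num.toNat : ℕ) : ℝ) = (x.num : ℝ) := by
    exact_mod_cast Int.toNat_of_nonneg hn0
  rw [hac]
  have hθ : |θ - x.num / q| ≤ 1 / (q * (8 * Y)) := by
    rw [le_div_iff₀ (by positivity)]
    refine le_trans ?_ hx'
    gcongr; linarith
  have hcop : IsCoprime x.num (q : ℤ) := by
    rw [Int.isCoprime_iff_nat_coprime]; simpa using x.reduced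
  have hmul := sum_multiples_le hY hq0 x.num hθ (weylMajorant Y θ) (weylMajorant_nonneg Y θ)
    (weylMajorant_le Y θ) (weylMajorant_mul_dist_le Y θ)
  have hnon := sum_nonmultiples_le hY hq0 hxd x.num hcop hθ (weylMajorant Y θ)
    (weylMajorant_nonneg Y θ) (weylMajorant_mul_dist_le Y θ)
  have hsplit := Finset.sum_filter_add_sum_filter_not (Finset.Icc 1 (4 * Y)) (fun n => q ∣ n)
    (weylMajorant Y θ)
  have hfil : ∑ n ∈ (Finset.Icc 1 (4 * Y)).filter (fun n => q ∣ n), weylMajorant Y θ n =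
      ∑ k ∈ Finset.range (4 * Y / q), weylMajorant Y θ (q * (k + 1)) := by
    symm
    refine Finset.sum_nbij (fun k => q * (k + 1)) ?_ ?_ ?_ fun _ _ => rfl
    · intro k hk
      have := (Nat.mul_le_mul_left q (Finset.mem_range.1 hk)).trans (Nat.mul_div_le _ _)
      simp only [Finset.mem_filter, Finset.mem_Icc]
      exact ⟨⟨Nat.mul_pos hq0 (by omega), this⟩, dvd_mul_right _ _⟩
    · intro a _ b _ h
      have := Nat.eq_of_mul_eq_mul_left hq0 h
      omega
    · intro n hn
      simp only [Finset.coe_filter, Finset.mem_Icc, Set.mem_ofPred_eq] at hn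
      obtain ⟨⟨hn1, hn2⟩, k, rfl⟩ := hn
      have hk : k ≠ 0 := by rintro rfl; simp at hn1
      refine ⟨k - 1, ?_, ?_⟩
      · simp only [Finset.coe_range, Set.mem_Iio]
        have : k ≤ 4 * Y / q := (Nat.le_div_iff_mul_le hq0).2 (by linarith)
        omega
      · simp only; congr 1; omega
  have hharm : (harmonic q : ℝ) ≤ 14 * (Y : ℝ) ^ (1 / 10 : ℝ) := by
    have h1 : (harmonic q : ℝ) ≤ 1 + Real.log q := harmonic_le_one_add_log q
    have h2 : Real.log q ≤ Real.log (8 * Y) := by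
      apply Real.log_le_log (by positivity); exact_mod_cast hxd
    have h3 : Real.log (8 * Y) = 3 * Real.log 2 + Real.log Y := by
      rw [Real.log_mul (by norm_num) (by positivity), show (8 : ℝ) = 2 ^ 3 by norm_num,
        Real.log_pow]; norm_num
    have h4 := Real.log_le_rpow_div (show (0 : ℝ) ≤ Y by positivity)
      (show (0 : ℝ) < 1 / 10 by norm_num)
    have h5 := Real.log_two_lt_d9
    have h6 : (1 : ℝ) ≤ (Y : ℝ) ^ (1 / 10 : ℝ) := Real.one_le_rpow hYr (by norm_num)
    have h7 : (Y : ℝ) ^ (1 / 10 : ℝ) / (1 / 10) = 10 * (Y : ℝ) ^ (1 / 10 : ℝ) := by ring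
    linarith
  have hpow : (Y : ℝ) * (Y : ℝ) ^ (1 / 10 : ℝ) = (Y : ℝ) ^ (11 / 10 : ℝ) := by
    rw [← Real.rpow_one_add' (by positivity) (by norm_num)]; norm_num
  have hYp : (Y : ℝ) ≤ (Y : ℝ) ^ (11 / 10 : ℝ) := by
    rw [← hpow]
    exact le_mul_of_one_le_right (by positivity) (Real.one_le_rpow hYr (by norm_num))
  have hnon' : 24 * (Y : ℝ) * (harmonic q : ℝ) ≤ 336 * (Y : ℝ) ^ (11 / 10 : ℝ) := by
    rw [← hpow]
    calc 24 * (Y : ℝ) * (harmonic q : ℝ) ≤ 24 * Y * (14 * (Y : ℝ) ^ (1 / 10 : ℝ)) := by gcongr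
      _ = _ := by ring
  have hdiff := norm_weylSum_sq_le hY θ
  rw [hfil] at hsplit
  have hm1 := le_max_left ((Y : ℝ) ^ 2 / q * (1 / √(max 1 ((Y : ℝ) ^ 2 * |θ - x.num / q|))))
    ((Y : ℝ) ^ (11 / 10 : ℝ))
  have hm2 := le_max_right ((Y : ℝ) ^ 2 / q * (1 / √(max 1 ((Y : ℝ) ^ 2 * |θ - x.num / q|))))
    ((Y : ℝ) ^ (11 / 10 : ℝ))
  linarith

lemma exists_sum_shift_le :
    ∃ C : ℝ, 0 < C ∧ ∀ (y : ℝ) (s : Finset ℕ),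
      ∑ c ∈ s, (max 1 |(c : ℝ) - y|) ^ (-(9 / 8) : ℝ) ≤ C := by
  set f : ℤ → ℝ := fun k => 3 ^ (9 / 8 : ℝ) * ((k.natAbs : ℝ) + 1) ^ (-(9 / 8) : ℝ) with hf
  have hf0 : ∀ k, 0 ≤ f k := fun k => by positivity
  have hnat : Summable fun n : ℕ => 3 ^ (9 / 8 : ℝ) * ((n : ℝ) + 1) ^ (-(9 / 8) : ℝ) := by
    apply Summable.mul_left
    have : Summable fun n : ℕ => (n : ℝ) ^ (-(9 / 8) : ℝ) :=
      Real.summable_nat_rpow.2 (by norm_num)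
    simpa using (summable_nat_add_iff 1).2 this
  have hsum : Summable f := by
    apply Summable.of_nat_of_neg
    · simpa [hf] using hnat
    · simpa [hf] using hnat
  refine ⟨(∑' k, f k) + 1, add_pos_of_nonneg_of_pos (tsum_nonneg hf0) one_pos, fun y s => ?_⟩
  have hpt : ∀ c ∈ s, (max 1 |(c : ℝ) - y|) ^ (-(9 / 8) : ℝ) ≤ f ((c : ℤ) - ⌊y⌋) := by
    intro c _
    have hk : (((c : ℤ) - ⌊y⌋).natAbs : ℝ) = |(c : ℝ) - ⌊y⌋| := by
      rw [Nat.cast_natAbs]; push_cast; rfl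
    have h1 : |(c : ℝ) - ⌊y⌋| ≤ |(c : ℝ) - y| + 1 := by
      have e : (c : ℝ) - ⌊y⌋ = (c - y) + Int.fract y := by
        rw [← Int.self_sub_floor]; ring
      rw [e]
      refine (abs_add_le _ _).trans ?_
      rw [abs_of_nonneg (Int.fract_nonneg y)]
      linarith [Int.fract_lt_one y]
    have h2 : ((((c : ℤ) - ⌊y⌋).natAbs : ℝ) + 1) / 3 ≤ max 1 |(c : ℝ) - y| := by
      rw [hk]
      have := le_max_left 1 |(c : ℝ) - y|
      have := le_max_right 1 |(c : ℝ) - y|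
      linarith
    calc _ ≤ (((((c : ℤ) - ⌊y⌋).natAbs : ℝ) + 1) / 3) ^ (-(9 / 8) : ℝ) :=
          Real.rpow_le_rpow_of_nonpos (by positivity) h2 (by norm_num)
      _ = f ((c : ℤ) - ⌊y⌋) := by
          simp only [hf]
          rw [Real.div_rpow (by positivity) (by norm_num),
            Real.rpow_neg (by norm_num : (0 : ℝ) ≤ 3), div_inv_eq_mul, mul_comm]
  have hinj : Set.InjOn (fun c : ℕ => (c : ℤ) - ⌊y⌋) s := by
    intro a _ b _ h; simpa using h
  calc _ ≤ ∑ c ∈ s, f ((c : ℤ) - ⌊y⌋) := Finset.sum_le_sum hpt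
    _ = ∑ k ∈ s.image (fun c : ℕ => (c : ℤ) - ⌊y⌋), f k := (Finset.sum_image hinj).symm
    _ ≤ ∑' k, f k := hsum.sum_le_tsum _ fun k _ => hf0 k
    _ ≤ _ := by linarith

/-- The `9/2`-th moment of the quadratic Weyl sum over the fractions with denominator `Y²`. -/
theorem exists_weylSum_moment_le :
    ∃ C : ℝ, 0 < C ∧ ∀ Y : ℕ, 0 < Y →
      ∑ c ∈ Finset.range (Y ^ 2), ‖weylSum Y (c / (Y ^ 2 : ℕ))‖ ^ (9 / 2 : ℝ) ≤
        C * (Y : ℝ) ^ (9 / 2 : ℝ) := by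
  obtain ⟨C₁, hC₁, hshift⟩ := exists_sum_shift_le
  have hsummable : Summable fun n : ℕ => (n : ℝ) ^ (-(5 / 4) : ℝ) :=
    Real.summable_nat_rpow.2 (by norm_num)
  set C₂ := ∑' n : ℕ, (n : ℝ) ^ (-(5 / 4) : ℝ)
  have hC₂ : 0 ≤ C₂ := tsum_nonneg fun n => by positivity
  refine ⟨1000 ^ (9 / 4 : ℝ) * (1 + 2 * C₁ * C₂), by positivity, fun Y hY => ?_⟩
  have hYr : (1 : ℝ) ≤ Y := by exact_mod_cast hY
  set P : ℕ → ℕ → ℕ → ℝ := fun c q a =>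
    (Y : ℝ) ^ (9 / 2 : ℝ) * (q : ℝ) ^ (-(9 / 4) : ℝ) *
      (max 1 |(c : ℝ) - (Y : ℝ) ^ 2 * a / q|) ^ (-(9 / 8) : ℝ) with hP
  have hP0 : ∀ c q a, 0 ≤ P c q a := fun c q a => by positivity
  have hpt : ∀ c ∈ Finset.range (Y ^ 2), ‖weylSum Y (c / (Y ^ 2 : ℕ))‖ ^ (9 / 2 : ℝ) ≤
      1000 ^ (9 / 4 : ℝ) * ((Y : ℝ) ^ (5 / 2 : ℝ) +
        ∑ q ∈ Finset.Icc 1 (8 * Y), ∑ a ∈ Finset.range (q + 1), P c q a) := by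
    intro c hc
    have hcY : (c : ℝ) < (Y ^ 2 : ℕ) := by exact_mod_cast Finset.mem_range.1 hc
    have hY2 : (0 : ℝ) < (Y ^ 2 : ℕ) := by positivity
    obtain ⟨q, hq, a, ha, hle⟩ := norm_weylSum_sq_le_major hY
      (θ := c / (Y ^ 2 : ℕ)) (by positivity) ((div_lt_one hY2).2 hcY)
    have hq1 : 1 ≤ q := (Finset.mem_Icc.1 hq).1
    have hq0 : (0 : ℝ) < q := by exact_mod_cast hq1
    set A := (Y : ℝ) ^ 2 / q * (1 / √(max 1 ((Y : ℝ) ^ 2 * |(c : ℝ) / (Y ^ 2 : ℕ) - a / q|)))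
        with hA
    have hA0 : 0 ≤ A := by positivity
    have hApow : A ^ (9 / 4 : ℝ) = P c q a := by
      have e1 : (Y : ℝ) ^ 2 * |(c : ℝ) / (Y ^ 2 : ℕ) - a / q| =
          |(c : ℝ) - (Y : ℝ) ^ 2 * a / q| := by
        rw [← abs_of_pos (show (0 : ℝ) < (Y : ℝ) ^ 2 by positivity), ← abs_mul,
          abs_of_pos (show (0 : ℝ) < (Y : ℝ) ^ 2 by positivity)]
        congr 1; push_cast; field_simp
      rw [hA, e1, hP]
      set m := max 1 |(c : ℝ) - (Y : ℝ) ^ 2 * a / q| with hm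
      have hm0 : 0 < m := by positivity
      rw [Real.mul_rpow (by positivity) (by positivity), Real.div_rpow (by positivity) hq0.le,
        one_div, Real.inv_rpow (by positivity), Real.sqrt_eq_rpow, ← Real.rpow_mul hm0.le,
        ← Real.rpow_natCast, ← Real.rpow_mul (by positivity), div_eq_mul_inv,
        ← Real.rpow_neg hq0.le, ← Real.rpow_neg hm0.le]
      norm_num
      exact Or.inl (by rw [hm])
    have hsum : P c q a ≤ ∑ q ∈ Finset.Icc 1 (8 * Y), ∑ a ∈ Finset.range (q + 1), P c q a :=
      (Finset.single_le_sum (f := fun a => P c q a) (fun _ _ => hP0 _ _ _) ha).trans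
        (Finset.single_le_sum (f := fun q => ∑ a ∈ Finset.range (q + 1), P c q a)
          (fun _ _ => Finset.sum_nonneg fun _ _ => hP0 _ _ _) hq)
    set n := ‖weylSum Y (c / (Y ^ 2 : ℕ))‖ with hn
    have hn0 : 0 ≤ n := norm_nonneg _
    calc n ^ (9 / 2 : ℝ) = (n ^ 2) ^ (9 / 4 : ℝ) := by
          rw [← Real.rpow_natCast, ← Real.rpow_mul hn0]; norm_num
      _ ≤ (1000 * max A ((Y : ℝ) ^ (11 / 10 : ℝ))) ^ (9 / 4 : ℝ) :=
          Real.rpow_le_rpow (by positivity) hle (by norm_num)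
      _ = 1000 ^ (9 / 4 : ℝ) * (max A ((Y : ℝ) ^ (11 / 10 : ℝ))) ^ (9 / 4 : ℝ) :=
          Real.mul_rpow (by norm_num) (by positivity)
      _ ≤ _ := by
          gcongr
          rcases max_choice A ((Y : ℝ) ^ (11 / 10 : ℝ)) with h | h
          · rw [h, hApow]
            exact hsum.trans (le_add_of_nonneg_left (by positivity))
          · rw [h, ← Real.rpow_mul (by positivity)]
            refine (Real.rpow_le_rpow_of_exponent_le hYr
              (by norm_num : (11 / 10 * (9 / 4) : ℝ) ≤ 5 / 2)).trans (le_add_of_nonneg_right ?_)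
            exact (hP0 c q a).trans hsum
  have hinner : ∀ q ∈ Finset.Icc 1 (8 * Y),
      ∑ a ∈ Finset.range (q + 1), ∑ c ∈ Finset.range (Y ^ 2), P c q a ≤
        2 * C₁ * (Y : ℝ) ^ (9 / 2 : ℝ) * (q : ℝ) ^ (-(5 / 4) : ℝ) := by
    intro q hq
    have hq1 : (1 : ℝ) ≤ q := by exact_mod_cast (Finset.mem_Icc.1 hq).1
    have hq0 : (0 : ℝ) < q := by linarith
    calc _ ≤ ∑ a ∈ Finset.range (q + 1),
          (Y : ℝ) ^ (9 / 2 : ℝ) * (q : ℝ) ^ (-(9 / 4) : ℝ) * C₁ := by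
          refine Finset.sum_le_sum fun a _ => ?_
          simp only [hP]
          rw [← Finset.mul_sum]
          exact mul_le_mul_of_nonneg_left (hshift _ _) (by positivity)
      _ = (q + 1) * ((Y : ℝ) ^ (9 / 2 : ℝ) * (q : ℝ) ^ (-(9 / 4) : ℝ) * C₁) := by simp
      _ ≤ (2 * q) * ((Y : ℝ) ^ (9 / 2 : ℝ) * (q : ℝ) ^ (-(9 / 4) : ℝ) * C₁) := by
          gcongr; linarith
      _ = 2 * C₁ * (Y : ℝ) ^ (9 / 2 : ℝ) * (q * (q : ℝ) ^ (-(9 / 4) : ℝ)) := by ring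
      _ = _ := by
          rw [← Real.rpow_one_add' hq0.le (by norm_num)]; norm_num
  calc _ ≤ ∑ c ∈ Finset.range (Y ^ 2), 1000 ^ (9 / 4 : ℝ) * ((Y : ℝ) ^ (5 / 2 : ℝ) +
        ∑ q ∈ Finset.Icc 1 (8 * Y), ∑ a ∈ Finset.range (q + 1), P c q a) := Finset.sum_le_sum hpt
    _ = 1000 ^ (9 / 4 : ℝ) * ((Y : ℝ) ^ 2 * (Y : ℝ) ^ (5 / 2 : ℝ) +
        ∑ q ∈ Finset.Icc 1 (8 * Y), ∑ a ∈ Finset.range (q + 1),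
          ∑ c ∈ Finset.range (Y ^ 2), P c q a) := by
        rw [← Finset.mul_sum, Finset.sum_add_distrib, Finset.sum_comm]
        congr 2
        · simp
        · exact Finset.sum_congr rfl fun q _ => Finset.sum_comm
    _ ≤ 1000 ^ (9 / 4 : ℝ) * ((Y : ℝ) ^ (9 / 2 : ℝ) +
        2 * C₁ * (Y : ℝ) ^ (9 / 2 : ℝ) * C₂) := by
        gcongr
        · rw [← Real.rpow_natCast, ← Real.rpow_add (by positivity)]; norm_num
        · refine (Finset.sum_le_sum hinner).trans ?_
          rw [← Finset.mul_sum]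
          gcongr
          exact hsummable.sum_le_tsum _ fun n _ => by positivity
    _ = _ := by ring

/-- The quadratic Weyl sum as a function on `ℤ/Y²`. -/
def weylZMod (Y : ℕ) (α : ZMod (Y ^ 2)) : ℂ :=
  weylSum Y ((α.val : ℝ) / (Y ^ 2 : ℕ))

/-- The lattice points of the open cube of side `2Y`. -/
def cube (d Y : ℕ) : Finset (Fin d → ℤ) :=
  Fintype.piFinset fun _ => Finset.Ioo (-(Y : ℤ)) Y

lemma AddChar.prod_map_eq_map_sum {ι A M : Type*} [AddCommMonoid A] [CommMonoid M]
    (ψ : AddChar A M) (s : Finset ι) (f : ι → A) : ∏ i ∈ s, ψ (f i) = ψ (∑ i ∈ s, f i) := by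
  classical
  induction s using Finset.induction_on with
  | empty => simp
  | insert a s ha ih => rw [Finset.prod_insert ha, Finset.sum_insert ha, ih, AddChar.map_add_eq_mul]

section ZModCount

variable {Y : ℕ} [NeZero Y]

lemma weylZMod_eq (α : ZMod (Y ^ 2)) :
    weylZMod Y α = ∑ j ∈ Finset.Ioo (-(Y : ℤ)) Y,
        ZMod.stdAddChar (α * ((j ^ 2 : ℤ) : ZMod (Y ^ 2))) := by
  unfold weylZMod weylSum
  refine Finset.sum_congr rfl fun j _ => ?_
  have : α * ((j ^ 2 : ℤ) : ZMod (Y ^ 2)) = ((α.val * j ^ 2 : ℤ) : ZMod (Y ^ 2)) := by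
    push_cast; rw [ZMod.natCast_zmod_val]
  rw [this, ZMod.stdAddChar_coe]
  congr 1; push_cast; ring

lemma weylZMod_pow_eq (d : ℕ) (α : ZMod (Y ^ 2)) :
    weylZMod Y α ^ d = ∑ u ∈ cube d Y,
      ZMod.stdAddChar (α * ((∑ i, u i ^ 2 : ℤ) : ZMod (Y ^ 2))) := by
  have : weylZMod Y α ^ d = ∏ _i : Fin d, weylZMod Y α := by simp
  rw [this, weylZMod_eq, Finset.prod_univ_sum]
  refine Finset.sum_congr rfl fun u _ => ?_
  rw [AddChar.prod_map_eq_map_sum, ← Finset.mul_sum]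
  push_cast; rfl

/-- The number of points of the cube on which `|u|²` lies in a given residue class. -/
def residueCount (d Y : ℕ) (z : ZMod (Y ^ 2)) : ℕ :=
  ((cube d Y).filter fun u => ((∑ i, u i ^ 2 : ℤ) : ZMod (Y ^ 2)) = z).card

lemma residueCount_eq (d : ℕ) (z : ZMod (Y ^ 2)) :
    ((Y ^ 2 : ℕ) : ℂ) * residueCount d Y z =
      ∑ α : ZMod (Y ^ 2), weylZMod Y α ^ d * ZMod.stdAddChar (-(α * z)) := by
  simp_rw [weylZMod_pow_eq, Finset.sum_mul]
  rw [Finset.sum_comm]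
  have : ∀ u ∈ cube d Y, ∑ α : ZMod (Y ^ 2),
      (ZMod.stdAddChar (α * ((∑ i, u i ^ 2 : ℤ) : ZMod (Y ^ 2))) : ℂ) *
        ZMod.stdAddChar (-(α * z)) =
      if ((∑ i, u i ^ 2 : ℤ) : ZMod (Y ^ 2)) = z then ((Y ^ 2 : ℕ) : ℂ) else 0 := by
    intro u _
    have h := AddChar.sum_mulShift (((∑ i, u i ^ 2 : ℤ) : ZMod (Y ^ 2)) - z)
      (ZMod.isPrimitive_stdAddChar (Y ^ 2))
    simp only [sub_eq_zero, ZMod.card] at h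
    rw [Nat.cast_ite, Nat.cast_zero] at h
    rw [← h]
    refine Finset.sum_congr rfl fun α _ => ?_
    rw [← AddChar.map_add_eq_mul]; congr 1; ring
  rw [Finset.sum_congr rfl this, ← Finset.sum_filter, Finset.sum_const, residueCount,
    nsmul_eq_mul, mul_comm]

lemma residueCount_le (d : ℕ) (z : ZMod (Y ^ 2)) :
    ((Y ^ 2 : ℕ) : ℝ) * residueCount d Y z ≤ ∑ α : ZMod (Y ^ 2), ‖weylZMod Y α‖ ^ d := by
  have h := congrArg norm (residueCount_eq d z)
  rw [norm_mul, Complex.norm_natCast, Complex.norm_natCast] at h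
  rw [h]
  refine (norm_sum_le _ _).trans (Finset.sum_le_sum fun α _ => ?_)
  rw [norm_mul, norm_pow, AddChar.norm_apply, mul_one]

lemma sum_residueCount_sq_le (d : ℕ) (z : ZMod (Y ^ 2)) :
    ((Y ^ 2 : ℕ) : ℝ) ^ 2 *
        ∑ w ∈ cube d Y, (residueCount d Y (z - ((∑ i, w i ^ 2 : ℤ) : ZMod (Y ^ 2))) : ℝ) ^ 2 ≤
      ∑ α : ZMod (Y ^ 2), ∑ β : ZMod (Y ^ 2),
        ‖weylZMod Y α‖ ^ d * ‖weylZMod Y β‖ ^ d * ‖weylZMod Y (α + β)‖ ^ d := by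
  have h : ((((Y ^ 2 : ℕ) : ℝ) ^ 2 *
        ∑ w ∈ cube d Y, (residueCount d Y (z - ((∑ i, w i ^ 2 : ℤ) : ZMod (Y ^ 2))) : ℝ) ^ 2
            : ℝ) : ℂ)
      = ∑ α : ZMod (Y ^ 2), ∑ β : ZMod (Y ^ 2),
        weylZMod Y α ^ d * weylZMod Y β ^ d * weylZMod Y (α + β) ^ d *
          ZMod.stdAddChar (-((α + β) * z)) := by
    push_cast
    rw [Finset.mul_sum]
    have h1 : ∀ w ∈ cube d Y, ((Y : ℂ) ^ 2) ^ 2 *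
        (residueCount d Y (z - ((∑ i, w i ^ 2 : ℤ) : ZMod (Y ^ 2))) : ℂ) ^ 2 =
        ∑ α : ZMod (Y ^ 2), ∑ β : ZMod (Y ^ 2), weylZMod Y α ^ d * weylZMod Y β ^ d *
          (ZMod.stdAddChar ((α + β) * ((∑ i, w i ^ 2 : ℤ) : ZMod (Y ^ 2))) *
            ZMod.stdAddChar (-((α + β) * z))) := by
      intro w _
      have := residueCount_eq (Y := Y) d (z - ((∑ i, w i ^ 2 : ℤ) : ZMod (Y ^ 2)))
      push_cast at this ⊢
      rw [← mul_pow, this, sq, Finset.sum_mul_sum]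
      refine Finset.sum_congr rfl fun α _ => Finset.sum_congr rfl fun β _ => ?_
      rw [← AddChar.map_add_eq_mul, mul_mul_mul_comm, ← AddChar.map_add_eq_mul]
      congr 2; ring
    push_cast at h1
    rw [Finset.sum_congr rfl h1, Finset.sum_comm]
    refine Finset.sum_congr rfl fun α _ => ?_
    rw [Finset.sum_comm]
    refine Finset.sum_congr rfl fun β _ => ?_
    rw [← Finset.mul_sum, ← Finset.sum_mul, weylZMod_pow_eq d (α + β)]
    push_cast
    ring
  have hn := congrArg norm h
  rw [Complex.norm_real, Real.norm_of_nonneg (by positivity)] at hn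
  rw [hn]
  refine (norm_sum_le _ _).trans (Finset.sum_le_sum fun α _ => ?_)
  refine (norm_sum_le _ _).trans (Finset.sum_le_sum fun β _ => ?_)
  rw [norm_mul, norm_mul, norm_mul, norm_pow, norm_pow, norm_pow, AddChar.norm_apply, mul_one]

lemma sum_zmod_eq_sum_range (f : ℕ → ℝ) :
    ∑ α : ZMod (Y ^ 2), f α.val = ∑ c ∈ Finset.range (Y ^ 2), f c := by
  refine Finset.sum_nbij' ZMod.val (fun c => (c : ZMod (Y ^ 2))) ?_ ?_ ?_ ?_ ?_
  · intro α _; exact Finset.mem_range.2 (ZMod.val_lt α)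
  · intro c _; exact Finset.mem_univ _
  · intro α _; exact ZMod.natCast_zmod_val α
  · intro c hc; exact ZMod.val_natCast_of_lt (Finset.mem_range.1 hc)
  · intro _ _; rfl

lemma norm_weylZMod_le (α : ZMod (Y ^ 2)) : ‖weylZMod Y α‖ ≤ 2 * Y := by
  rw [weylZMod_eq]
  refine (norm_sum_le _ _).trans ?_
  simp only [AddChar.norm_apply, Finset.sum_const, Int.card_Ioo, nsmul_eq_mul, mul_one]
  have : ((Y : ℤ) - -Y - 1).toNat ≤ 2 * Y := by omega
  exact_mod_cast this

end ZModCount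

lemma exists_weylZMod_moment_le (s : ℝ) (hs : 9 / 2 ≤ s) :
    ∃ C : ℝ, 0 < C ∧ ∀ (Y : ℕ) [NeZero Y],
      ∑ α : ZMod (Y ^ 2), ‖weylZMod Y α‖ ^ s ≤ C * (Y : ℝ) ^ s := by
  obtain ⟨C, hC, h⟩ := exists_weylSum_moment_le
  refine ⟨2 ^ (s - 9 / 2) * C, by positivity, fun Y _ => ?_⟩
  have hY : 0 < Y := Nat.pos_of_ne_zero (NeZero.ne Y)
  have hYr : (0 : ℝ) < Y := by exact_mod_cast hY
  have hm : ∑ α : ZMod (Y ^ 2), ‖weylZMod Y α‖ ^ (9 / 2 : ℝ) ≤ C * (Y : ℝ) ^ (9 / 2 : ℝ) := by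
    refine le_trans (le_of_eq ?_) (h Y hY)
    exact sum_zmod_eq_sum_range fun c => ‖weylSum Y (c / (Y ^ 2 : ℕ))‖ ^ (9 / 2 : ℝ)
  have hpt : ∀ x : ℝ, 0 ≤ x → x ≤ 2 * Y →
      x ^ s ≤ (2 * Y : ℝ) ^ (s - 9 / 2) * x ^ (9 / 2 : ℝ) := by
    intro x hx hxY
    have : x ^ s = x ^ (s - 9 / 2) * x ^ (9 / 2 : ℝ) := by
      rw [← Real.rpow_add_of_nonneg hx (by linarith) (by norm_num)]; congr 1; ring
    rw [this]
    gcongr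
  calc _ ≤ ∑ α : ZMod (Y ^ 2), (2 * Y : ℝ) ^ (s - 9 / 2) * ‖weylZMod Y α‖ ^ (9 / 2 : ℝ) :=
        Finset.sum_le_sum fun α _ => hpt _ (norm_nonneg _) (norm_weylZMod_le α)
    _ ≤ (2 * Y : ℝ) ^ (s - 9 / 2) * (C * (Y : ℝ) ^ (9 / 2 : ℝ)) := by
        rw [← Finset.mul_sum]; gcongr
    _ = 2 ^ (s - 9 / 2) * C * ((Y : ℝ) ^ (s - 9 / 2) * (Y : ℝ) ^ (9 / 2 : ℝ)) := by
        rw [Real.mul_rpow (by norm_num) hYr.le]; ring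
    _ = _ := by rw [← Real.rpow_add hYr]; congr 2; ring

/-- The number of points of the cube on the sphere `|u|² = m`. -/
def sphereCount (d Y : ℕ) (m : ℤ) : ℕ := ((cube d Y).filter fun u => ∑ i, u i ^ 2 = m).card

lemma sphereCount_le_residueCount (d Y : ℕ) (m : ℤ) :
    sphereCount d Y m ≤ residueCount d Y (m : ZMod (Y ^ 2)) := by
  refine Finset.card_le_card fun u hu => ?_
  rw [Finset.mem_filter] at *
  exact ⟨hu.1, by rw [hu.2]⟩

/-- Uniform upper bound for the number of lattice points on spheres in dimension at least five. -/
theorem exists_sphereCount_le (d : ℕ) (hd : 5 ≤ d) :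
    ∃ C : ℝ, 0 < C ∧ ∀ (Y : ℕ), 0 < Y → ∀ m : ℤ,
      (sphereCount d Y m : ℝ) ≤ C * (Y : ℝ) ^ (d - 2) := by
  have hdr : (5 : ℝ) ≤ d := by exact_mod_cast hd
  obtain ⟨C, hC, h⟩ := exists_weylZMod_moment_le d (by linarith)
  refine ⟨C, hC, fun Y hY m => ?_⟩
  have : NeZero Y := ⟨hY.ne'⟩
  have hYr : (0 : ℝ) < Y := by exact_mod_cast hY
  have h1 := (residueCount_le (Y := Y) d (m : ZMod (Y ^ 2)))
  have h2 := h Y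
  simp only [Real.rpow_natCast] at h2
  have h3 : (sphereCount d Y m : ℝ) ≤ residueCount d Y (m : ZMod (Y ^ 2)) := by
    exact_mod_cast sphereCount_le_residueCount d Y m
  have h4 : (Y : ℝ) ^ 2 * (sphereCount d Y m : ℝ) ≤ (Y : ℝ) ^ 2 * (C * (Y : ℝ) ^ (d - 2)) := by
    calc _ ≤ ((Y ^ 2 : ℕ) : ℝ) * residueCount d Y (m : ZMod (Y ^ 2)) := by push_cast; gcongr
      _ ≤ C * (Y : ℝ) ^ d := h1.trans h2
      _ = _ := by
        rw [mul_left_comm, ← pow_add]; congr 2; omega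
  exact le_of_mul_le_mul_left h4 (by positivity)

lemma mul_mul_le_of_nonneg {a b c : ℝ} (ha : 0 ≤ a) (hb : 0 ≤ b) (hc : 0 ≤ c) :
    a * b * c ≤ (a ^ (3 / 2 : ℝ) * b ^ (3 / 2 : ℝ) + b ^ (3 / 2 : ℝ) * c ^ (3 / 2 : ℝ) +
      a ^ (3 / 2 : ℝ) * c ^ (3 / 2 : ℝ)) / 3 := by
  have key := Real.geom_mean_le_arith_mean3_weighted (w₁ := 1 / 3) (w₂ := 1 / 3) (w₃ := 1 / 3)
    (p₁ := (a * b) ^ (3 / 2 : ℝ)) (p₂ := (b * c) ^ (3 / 2 : ℝ)) (p₃ := (a * c) ^ (3 / 2 : ℝ))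
    (by norm_num) (by norm_num) (by norm_num) (by positivity) (by positivity) (by positivity)
    (by norm_num)
  have h : ∀ x : ℝ, 0 ≤ x → (x ^ (3 / 2 : ℝ)) ^ (1 / 3 : ℝ) = √x := by
    intro x hx
    rw [← Real.rpow_mul hx, Real.sqrt_eq_rpow]; norm_num
  rw [h _ (by positivity), h _ (by positivity), h _ (by positivity),
    ← Real.sqrt_mul (by positivity),
    ← Real.sqrt_mul (by positivity), show a * b * (b * c) * (a * c) = (a * b * c) ^ 2 by ring,
    Real.sqrt_sq (by positivity), Real.mul_rpow ha hb, Real.mul_rpow hb hc,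
    Real.mul_rpow ha hc] at key
  linarith

lemma sum_sum_mul_mul_le {G : Type*} [AddCommGroup G] [Fintype G] (A : G → ℝ) (hA : ∀ x, 0 ≤ A x) :
    ∑ x, ∑ y, A x * A y * A (x + y) ≤ (∑ x, A x ^ (3 / 2 : ℝ)) ^ 2 := by
  set B : G → ℝ := fun x => A x ^ (3 / 2 : ℝ) with hB
  have hshift : ∀ x, ∑ y, B (x + y) = ∑ y, B y := fun x =>
    Fintype.sum_equiv (Equiv.addLeft x) _ _ fun _ => rfl
  have hshift' : ∀ y, ∑ x, B (x + y) = ∑ x, B x := fun y =>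
    Fintype.sum_equiv (Equiv.addRight y) _ _ fun _ => rfl
  calc _ ≤ ∑ x, ∑ y, (B x * B y + B y * B (x + y) + B x * B (x + y)) / 3 :=
        Finset.sum_le_sum fun x _ => Finset.sum_le_sum fun y _ =>
          mul_mul_le_of_nonneg (hA _) (hA _) (hA _)
    _ = (∑ x, ∑ y, B x * B y + ∑ y, ∑ x, B y * B (x + y) + ∑ x, ∑ y, B x * B (x + y)) / 3 := by
        rw [Finset.sum_comm (f := fun y x => B y * B (x + y))]
        simp_rw [← Finset.sum_div, Finset.sum_add_distrib]
    _ = _ := by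
        simp_rw [← Finset.mul_sum, hshift, hshift', ← Finset.sum_mul]
        ring

/-- Second moment bound for the number of lattice points on slices of spheres. -/
theorem exists_sum_sphereCount_sq_le (d : ℕ) (hd : 3 ≤ d) :
    ∃ C : ℝ, 0 < C ∧ ∀ (Y : ℕ), 0 < Y → ∀ m : ℤ,
      ∑ w ∈ cube d Y, (sphereCount d Y (m - ∑ i, w i ^ 2) : ℝ) ^ 2 ≤
        C * (Y : ℝ) ^ (3 * d - 4) := by
  have hdr : (3 : ℝ) ≤ d := by exact_mod_cast hd
  obtain ⟨C, hC, h⟩ := exists_weylZMod_moment_le (d * (3 / 2)) (by linarith)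
  refine ⟨C ^ 2, by positivity, fun Y hY m => ?_⟩
  have : NeZero Y := ⟨hY.ne'⟩
  have hYr : (0 : ℝ) < Y := by exact_mod_cast hY
  have h1 := (sum_residueCount_sq_le (Y := Y) d (m : ZMod (Y ^ 2))).trans
    (sum_sum_mul_mul_le (fun α => ‖weylZMod Y α‖ ^ d) fun _ => by positivity)
  have h2 : ∑ α : ZMod (Y ^ 2), (‖weylZMod Y α‖ ^ d) ^ (3 / 2 : ℝ) ≤
      C * (Y : ℝ) ^ ((d : ℝ) * (3 / 2)) := by
    refine le_trans (le_of_eq (Finset.sum_congr rfl fun α _ => ?_)) (h Y)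
    rw [← Real.rpow_natCast, ← Real.rpow_mul (norm_nonneg _)]
  have h3 : ∑ w ∈ cube d Y, (sphereCount d Y (m - ∑ i, w i ^ 2) : ℝ) ^ 2 ≤
      ∑ w ∈ cube d Y,
        (residueCount d Y ((m : ZMod (Y ^ 2)) - ((∑ i, w i ^ 2 : ℤ) : ZMod (Y ^ 2))) : ℝ) ^ 2 := by
    refine Finset.sum_le_sum fun w _ => ?_
    have := sphereCount_le_residueCount d Y (m - ∑ i, w i ^ 2)
    rw [Int.cast_sub] at this
    gcongr
  have h5 : (C * (Y : ℝ) ^ ((d : ℝ) * (3 / 2))) ^ 2 = C ^ 2 * (Y : ℝ) ^ (3 * d) := by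
    have : ((Y : ℝ) ^ ((d : ℝ) * (3 / 2))) ^ 2 = (Y : ℝ) ^ (3 * d) := by
      rw [← Real.rpow_natCast, ← Real.rpow_mul hYr.le, ← Real.rpow_natCast (Y : ℝ) (3 * d)]
      congr 1; push_cast; ring
    rw [mul_pow, this]
  have h4 : (Y : ℝ) ^ 4 * ∑ w ∈ cube d Y, (sphereCount d Y (m - ∑ i, w i ^ 2) : ℝ) ^ 2 ≤
      (Y : ℝ) ^ 4 * (C ^ 2 * (Y : ℝ) ^ (3 * d - 4)) := by
    calc _ ≤ ((Y ^ 2 : ℕ) : ℝ) ^ 2 * ∑ w ∈ cube d Y,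
        (residueCount d Y ((m : ZMod (Y ^ 2)) - ((∑ i, w i ^ 2 : ℤ) : ZMod (Y ^ 2))) : ℝ) ^ 2 := by
          push_cast at h3 ⊢
          rw [← pow_mul]; gcongr
      _ ≤ (C * (Y : ℝ) ^ ((d : ℝ) * (3 / 2))) ^ 2 := h1.trans (by gcongr)
      _ = C ^ 2 * (Y : ℝ) ^ (3 * d) := h5
      _ = _ := by
        rw [mul_left_comm, ← pow_add]; congr 2; omega
  exact le_of_mul_le_mul_left h4 (by positivity)

/-- The quadratic character modulo four as an arithmetic function. -/
def chiFour : ArithmeticFunction ℤ := ⟨fun n => ZMod.χ₄ (n : ZMod 4), by simp⟩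

lemma chiFour_apply (n : ℕ) : chiFour n = ZMod.χ₄ (n : ZMod 4) := rfl

/-- The divisor sum of the quadratic character modulo four. -/
def divisorSumChiFour : ArithmeticFunction ℤ := chiFour * ArithmeticFunction.zeta

lemma divisorSumChiFour_apply (n : ℕ) :
    divisorSumChiFour n = ∑ k ∈ n.divisors, ZMod.χ₄ (k : ZMod 4) :=
  ArithmeticFunction.coe_mul_zeta_apply

lemma isMultiplicative_divisorSumChiFour : divisorSumChiFour.IsMultiplicative := by
  refine ArithmeticFunction.IsMultiplicative.mul ⟨by simp [chiFour_apply], fun {m n} _ => ?_⟩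
    ArithmeticFunction.isMultiplicative_zeta.natCast
  rw [chiFour_apply, chiFour_apply, chiFour_apply, Nat.cast_mul, map_mul]

lemma divisorSumChiFour_prime_pow {p : ℕ} (hp : p.Prime) (k : ℕ) :
    divisorSumChiFour (p ^ k) = ∑ i ∈ Finset.range (k + 1), ZMod.χ₄ (p : ZMod 4) ^ i := by
  rw [divisorSumChiFour_apply, Nat.sum_divisors_prime_pow hp]
  simp only [Nat.cast_pow, map_pow]

/-- A finite set of pairwise non-associated Gaussian integers of norm `n`. -/
def IsNormFamily (n : ℕ) (s : Finset GaussianInt) : Prop :=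
  (∀ z ∈ s, z.norm = n) ∧ ∀ z ∈ s, ∀ w ∈ s, Associated z w → z = w

lemma IsNormFamily.singleton {n : ℕ} {z : GaussianInt} (hz : z.norm = n) :
    IsNormFamily n {z} := by
  refine ⟨by simpa using hz, fun a ha b hb _ => ?_⟩
  rw [Finset.mem_singleton.1 ha, Finset.mem_singleton.1 hb]

lemma isCoprime_of_norm_coprime {m n : ℕ} (h : m.Coprime n) {z w : GaussianInt}
    (hz : z.norm = m) (hw : w.norm = n) : IsCoprime z w := by
  obtain ⟨a, b, hab⟩ := Nat.isCoprime_iff_coprime.2 h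
  refine ⟨a * star z, b * star w, ?_⟩
  have hz' := Zsqrtd.norm_eq_mul_conj z
  have hw' := Zsqrtd.norm_eq_mul_conj w
  rw [hz] at hz'
  rw [hw] at hw'
  calc _ = (a : GaussianInt) * (z * star z) + b * (w * star w) := by ring
    _ = ((a * m + b * n : ℤ) : GaussianInt) := by rw [← hz', ← hw']; push_cast; ring
    _ = 1 := by rw [hab]; simp

lemma associated_of_mul {z w z' w' : GaussianInt} (h : Associated (z * w) (z' * w'))
    (h1 : IsCoprime z w') (h2 : IsCoprime z' w) : Associated z z' :=
  associated_of_dvd_dvd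
    (h1.dvd_of_dvd_mul_right ((Dvd.intro _ rfl).trans h.dvd))
    (h2.dvd_of_dvd_mul_right ((Dvd.intro _ rfl).trans h.symm.dvd))

lemma IsNormFamily.mul {m n : ℕ} (h : m.Coprime n) {s t : Finset GaussianInt}
    (hs : IsNormFamily m s) (ht : IsNormFamily n t) :
    ∃ u, IsNormFamily (m * n) u ∧ u.card = s.card * t.card := by
  classical
  have key : ∀ p ∈ s ×ˢ t, ∀ q ∈ s ×ˢ t, Associated (p.1 * p.2) (q.1 * q.2) → p = q := by
    rintro ⟨z, w⟩ hp ⟨z', w'⟩ hq hassoc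
    rw [Finset.mem_product] at hp hq
    dsimp only at *
    refine Prod.ext (hs.2 _ hp.1 _ hq.1 ?_) (ht.2 _ hp.2 _ hq.2 ?_)
    · exact associated_of_mul hassoc (isCoprime_of_norm_coprime h (hs.1 _ hp.1) (ht.1 _ hq.2))
        (isCoprime_of_norm_coprime h (hs.1 _ hq.1) (ht.1 _ hp.2))
    · rw [mul_comm z, mul_comm z'] at hassoc
      exact associated_of_mul hassoc
        (isCoprime_of_norm_coprime h (hs.1 _ hq.1) (ht.1 _ hp.2)).symm
        (isCoprime_of_norm_coprime h (hs.1 _ hp.1) (ht.1 _ hq.2)).symm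
  refine ⟨(s ×ˢ t).image fun p => p.1 * p.2, ⟨?_, ?_⟩, ?_⟩
  · intro z hz
    obtain ⟨p, hp, rfl⟩ := Finset.mem_image.1 hz
    rw [Finset.mem_product] at hp
    rw [Zsqrtd.norm_mul, hs.1 _ hp.1, ht.1 _ hp.2]; simp
  · intro z hz w hw hzw
    obtain ⟨p, hp, rfl⟩ := Finset.mem_image.1 hz
    obtain ⟨q, hq, rfl⟩ := Finset.mem_image.1 hw
    rw [key p hp q hq hzw]
  · rw [Finset.card_image_of_injOn, Finset.card_product]
    intro p hp q hq hpq
    exact key p hp q hq (by simp only at hpq; rw [hpq])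

lemma gaussianInt_norm_pow (z : GaussianInt) (k : ℕ) : (z ^ k).norm = z.norm ^ k :=
  map_pow Zsqrtd.normMonoidHom z k

lemma exists_isNormFamily_prime_pow_of_one {p : ℕ} (hp : p.Prime) (h1 : p % 4 = 1) (k : ℕ) :
    ∃ s, IsNormFamily (p ^ k) s ∧ s.card = k + 1 := by
  classical
  have : Fact p.Prime := ⟨hp⟩
  obtain ⟨a, b, hab⟩ := Nat.Prime.sq_add_sq (p := p) (by omega)
  set π : GaussianInt := ⟨a, b⟩ with hπ
  have hnorm : π.norm = p := by
    rw [hπ, Zsqrtd.norm_def]; dsimp only; rw [← hab]; push_cast; ring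
  have hnorm' : (star π).norm = p := by rw [Zsqrtd.norm_conj, hnorm]
  have hcop : IsCoprime π (star π) := by
    have h2a : Nat.Coprime p (2 * a) := by
      rw [Nat.Prime.coprime_iff_not_dvd hp]
      intro hdvd
      rcases (Nat.Prime.dvd_mul hp).1 hdvd with h | h
      · have := Nat.le_of_dvd (by norm_num) h
        have := hp.two_le
        have : p = 2 := by omega
        subst this; omega
      · rcases Nat.eq_zero_or_pos a with h0 | h0
        · subst h0
          have : p = b ^ 2 := by rw [← hab]; ring
          exact (Nat.Prime.not_prime_pow (n := 2) le_rfl) (this ▸ hp)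
        · have h3 := Nat.le_of_dvd h0 h
          have := hp.two_le
          nlinarith
    obtain ⟨x, y, hxy⟩ := Nat.isCoprime_iff_coprime.2 h2a
    have hsum : π + star π = ((2 * a : ℕ) : ℤ) := by
      ext <;> simp [hπ]; ring
    have hmul := Zsqrtd.norm_eq_mul_conj π
    rw [hnorm] at hmul
    refine ⟨x * star π + y, y, ?_⟩
    calc _ = (x : GaussianInt) * (π * star π) + y * (π + star π) := by ring
      _ = ((x * p + y * ((2 * a : ℕ) : ℤ) : ℤ) : GaussianInt) := by
          rw [← hmul, hsum]; push_cast; ring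
      _ = 1 := by rw [hxy]; simp
  have hunit : ¬ IsUnit π := by
    rw [← Zsqrtd.norm_eq_one_iff, hnorm]
    simpa using hp.one_lt.ne'
  have h0 : π ≠ 0 := fun h => hunit.elim (by
    rw [h, Zsqrtd.norm_zero] at hnorm
    exact absurd hnorm.symm (by exact_mod_cast hp.ne_zero))
  have h0' : star π ≠ 0 := star_ne_zero.2 h0
  have key : ∀ i ≤ k, ∀ j ≤ k, i < j →
      ¬ Associated (π ^ i * star π ^ (k - i)) (π ^ j * star π ^ (k - j)) := by
    intro i hi j hj hij hassoc
    have hdvd : π ^ i * π ∣ π ^ i * star π ^ (k - i) := by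
      refine dvd_trans ?_ hassoc.symm.dvd
      rw [← pow_succ]
      exact (pow_dvd_pow π hij).trans (Dvd.intro _ rfl)
    have hdvd' := (mul_dvd_mul_iff_left (pow_ne_zero i h0)).1 hdvd
    exact hunit ((hcop.pow_right (n := k - i)).isUnit_of_dvd' dvd_rfl hdvd')
  have key' : ∀ i ≤ k, ∀ j ≤ k,
      Associated (π ^ i * star π ^ (k - i)) (π ^ j * star π ^ (k - j)) → i = j := by
    intro i hi j hj h
    rcases lt_trichotomy i j with hij | hij | hij
    · exact (key i hi j hj hij h).elim
    · exact hij
    · exact (key j hj i hi hij h.symm).elim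
  refine ⟨(Finset.range (k + 1)).image fun i => π ^ i * star π ^ (k - i), ⟨?_, ?_⟩, ?_⟩
  · intro z hz
    obtain ⟨i, hi, rfl⟩ := Finset.mem_image.1 hz
    rw [Zsqrtd.norm_mul, gaussianInt_norm_pow, gaussianInt_norm_pow, hnorm, hnorm', ← pow_add,
      Nat.add_sub_cancel' (Nat.lt_succ_iff.1 (Finset.mem_range.1 hi))]
    simp
  · intro z hz w hw hzw
    obtain ⟨i, hi, rfl⟩ := Finset.mem_image.1 hz
    obtain ⟨j, hj, rfl⟩ := Finset.mem_image.1 hw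
    rw [key' i (by simpa [Nat.lt_succ_iff] using hi) j (by simpa [Nat.lt_succ_iff] using hj) hzw]
  · rw [Finset.card_image_of_injOn, Finset.card_range]
    intro i hi j hj hij
    refine key' i (by simpa [Nat.lt_succ_iff] using hi) j (by simpa [Nat.lt_succ_iff] using hj) ?_
    simp only at hij; rw [hij]

lemma exists_isNormFamily_prime_pow {p : ℕ} (hp : p.Prime) (k : ℕ) :
    0 ≤ divisorSumChiFour (p ^ k) ∧
      ∃ s, IsNormFamily (p ^ k) s ∧ divisorSumChiFour (p ^ k) ≤ s.card := by
  rw [divisorSumChiFour_prime_pow hp]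
  have hcases : p = 2 ∨ p % 4 = 1 ∨ p % 4 = 3 := by
    rcases hp.eq_two_or_odd with h | h
    · exact Or.inl h
    · omega
  rcases hcases with rfl | h1 | h3
  · have h2 : ZMod.χ₄ ((2 : ℕ) : ZMod 4) = 0 := by decide
    have hs : ∑ i ∈ Finset.range (k + 1), (0 : ℤ) ^ i = 1 := by
      rw [Finset.sum_range_succ']; simp
    rw [h2, hs]
    refine ⟨zero_le_one, {(⟨1, 1⟩ : GaussianInt) ^ k}, IsNormFamily.singleton ?_, by simp⟩
    rw [gaussianInt_norm_pow, Zsqrtd.norm_def]; norm_num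
  · rw [ZMod.χ₄_nat_one_mod_four h1]
    obtain ⟨s, hs, hc⟩ := exists_isNormFamily_prime_pow_of_one hp h1 k
    refine ⟨by simp; positivity, s, hs, by rw [hc]; simp⟩
  · rw [ZMod.χ₄_nat_three_mod_four h3, neg_one_geom_sum]
    by_cases hk : Even (k + 1)
    · simp only [hk, if_true]
      exact ⟨le_rfl, ∅, ⟨by simp, by simp⟩, by simp⟩
    · simp only [hk, if_false]
      refine ⟨zero_le_one, {((p : ℤ) : GaussianInt) ^ (k / 2)}, IsNormFamily.singleton ?_, by simp⟩
      have hk2 : 2 * (k / 2) = k := by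
        rw [Nat.even_add_one, not_not] at hk
        exact Nat.two_mul_div_two_of_even hk
      rw [gaussianInt_norm_pow, Zsqrtd.norm_intCast, ← sq, ← pow_mul, hk2]; simp

lemma exists_isNormFamily (n : ℕ) :
    0 ≤ divisorSumChiFour n ∧ ∃ s, IsNormFamily n s ∧ divisorSumChiFour n ≤ s.card := by
  induction n using Nat.recOnPosPrimePosCoprime with
  | prime_pow p k hp _ => exact exists_isNormFamily_prime_pow hp k
  | zero => exact ⟨by simp, ∅, ⟨by simp, by simp⟩, by simp⟩
  | one => simpa using exists_isNormFamily_prime_pow Nat.prime_two 0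
  | coprime a b _ _ hab iha ihb =>
    obtain ⟨ha, s, hs, hsc⟩ := iha
    obtain ⟨hb, t, ht, htc⟩ := ihb
    obtain ⟨u, hu, huc⟩ := hs.mul hab ht
    rw [isMultiplicative_divisorSumChiFour.map_mul_of_coprime hab]
    refine ⟨mul_nonneg ha hb, u, hu, ?_⟩
    rw [huc]; push_cast
    exact mul_le_mul hsc htc hb (by positivity)

/-- Lower bound for the number of representations of an odd number as a sum of two squares, the
first of which is odd. -/
lemma exists_odd_sq_add_sq_family {n : ℕ} (hn : Odd n) :
    ∃ s : Finset (ℤ × ℤ), (∀ z ∈ s, z.1 ^ 2 + z.2 ^ 2 = n ∧ Odd z.1) ∧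
      divisorSumChiFour n ≤ s.card := by
  classical
  obtain ⟨-, s, hs, hc⟩ := exists_isNormFamily n
  let φ : GaussianInt → GaussianInt := fun z => if Odd z.re then z else ⟨0, 1⟩ * z
  have hI : IsUnit (⟨0, 1⟩ : GaussianInt) := by
    rw [← Zsqrtd.norm_eq_one_iff]; simp [Zsqrtd.norm_def]
  have hφ : ∀ z, Associated z (φ z) := by
    intro z
    by_cases h : Odd z.re
    · simp only [φ, h, if_true]; rfl
    · simp only [φ, h, if_false]
      exact ⟨hI.unit, mul_comm _ _⟩
  refine ⟨s.image fun z => ((φ z).re, (φ z).im), ?_, ?_⟩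
  · intro z hz
    obtain ⟨w, hw, rfl⟩ := Finset.mem_image.1 hz
    have h1 := hs.1 w hw
    rw [Zsqrtd.norm_def] at h1
    by_cases h : Odd w.re
    · simp only [φ, h, if_true]
      exact ⟨by linarith, trivial⟩
    · simp only [φ, h, if_false, Zsqrtd.re_mul, Zsqrtd.im_mul]
      refine ⟨by linarith, ?_⟩
      have h2 : Odd (w.re * w.re + w.im * w.im) := by
        rw [show w.re * w.re + w.im * w.im = (n : ℤ) by linarith]; exact_mod_cast hn
      rw [Int.not_odd_iff_even] at h
      have h3 : Odd (w.im * w.im) := by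
        rw [Int.odd_add'] at h2
        exact h2.2 (h.mul_left _)
      have h4 := (Int.odd_mul.1 h3).1
      simpa using h4
  · rw [Finset.card_image_of_injOn]
    · exact hc
    · intro z hz w hw hzw
      have : φ z = φ w := by
        simp only [Prod.mk.injEq] at hzw
        exact Zsqrtd.ext hzw.1 hzw.2
      exact hs.2 z hz w hw ((hφ z).trans (this ▸ (hφ w).symm))

lemma chi_four_add_mul_chi_four_sub {x z : ℤ} (h : Odd (z + x)) :
    ZMod.χ₄ ((z + x : ℤ) : ZMod 4) * ZMod.χ₄ ((z - x : ℤ) : ZMod 4) = if Even x then 1 else -1 := by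
  rw [ZMod.χ₄_int_eq_if_mod_four, ZMod.χ₄_int_eq_if_mod_four]
  rw [Int.odd_iff] at h
  simp only [Int.even_iff]
  split_ifs <;> first | rfl | omega

/-- The quadruples on which Liouville's involution acts. -/
def liouvilleSet (n : ℤ) : Finset (ℤ × ℤ × ℤ × ℤ) :=
  (Finset.Icc (-(n + 1)) (n + 1) ×ˢ Finset.Icc (-(n + 1)) (n + 1) ×ˢ
    Finset.Icc (-(n + 1)) (n + 1) ×ˢ Finset.Icc (-(n + 1)) (n + 1)).filter fun w =>
      (0 < w.1 ∧ w.1 < w.2.1 ∧ -w.2.2.1 < w.2.2.2 ∧ w.2.2.2 < w.2.2.1) ∧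
        Odd (w.2.1 + w.1) ∧ Odd (w.2.2.1 + w.2.2.2) ∧ w.2.1 * w.2.2.1 + w.1 * w.2.2.2 = n

lemma mem_liouvilleSet {n x z y t : ℤ} :
    (x, z, y, t) ∈ liouvilleSet n ↔ (0 < x ∧ x < z ∧ -y < t ∧ t < y) ∧
      Odd (z + x) ∧ Odd (y + t) ∧ z * y + x * t = n := by
  simp only [liouvilleSet, Finset.mem_filter, Finset.mem_product, Finset.mem_Icc,
    and_iff_right_iff_imp]
  rintro ⟨⟨hx, hxz, hty, hty'⟩, -, -, h⟩
  have h1 : z + y ≤ n + 1 := by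
    nlinarith [mul_nonneg hx.le (show (0 : ℤ) ≤ t + (y - 1) by omega),
      mul_nonneg (show (0 : ℤ) ≤ z - 1 - x by omega) (show (0 : ℤ) ≤ y - 1 by omega)]
  omega

lemma even_iff_of_mem_liouvilleSet {n x z y t : ℤ} (hn : Odd n)
    (h : (x, z, y, t) ∈ liouvilleSet n) :
    Even x ↔ ¬ Even y := by
  obtain ⟨-, h1, h2, h3⟩ := mem_liouvilleSet.1 h
  rw [← h3, Int.odd_add, Int.odd_mul, Int.even_mul] at hn
  rw [Int.odd_add] at h1 h2
  simp only [← Int.not_even_iff_odd] at *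
  tauto

/-- Liouville's involution. -/
def liouvilleMap (w : ℤ × ℤ × ℤ × ℤ) : ℤ × ℤ × ℤ × ℤ :=
  (w.2.2.1, w.2.2.2 + 2 * ((w.2.1 + w.1) / (2 * w.1)) * w.2.2.1, w.1,
    w.2.1 - 2 * ((w.2.1 + w.1) / (2 * w.1)) * w.1)

lemma liouvilleMap_mem {n : ℤ} {w : ℤ × ℤ × ℤ × ℤ} (hw : w ∈ liouvilleSet n) :
    liouvilleMap w ∈ liouvilleSet n ∧ liouvilleMap (liouvilleMap w) = w := by
  obtain ⟨x, z, y, t⟩ := w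
  obtain ⟨⟨hx, hxz, hty, hty'⟩, ho1, ho2, h⟩ := mem_liouvilleSet.1 hw
  set v := (z + x) / (2 * x) with hv
  have hv1 : v * (2 * x) ≤ z + x := Int.ediv_mul_le _ (by omega)
  have hv2 : z + x < (v + 1) * (2 * x) := Int.lt_ediv_add_one_mul_self _ (by omega)
  have hv3 : 1 ≤ v := by
    rw [hv, Int.le_ediv_iff_mul_le (by omega)]; omega
  have hne : v * (2 * x) ≠ z + x := by
    intro he
    rw [← he] at ho1
    exact (Int.not_odd_iff_even.2 ((even_two_mul x).mul_left v)) ho1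
  have hv' : (t + 2 * v * y + y) / (2 * y) = v := by
    rw [show t + 2 * v * y + y = (t + y) + v * (2 * y) by ring,
      Int.add_mul_ediv_right _ _ (by omega), Int.ediv_eq_zero_of_lt (by omega) (by omega), zero_add]
  have hm : liouvilleMap (x, z, y, t) = (y, t + 2 * v * y, x, z - 2 * v * x) := rfl
  rw [hm]
  refine ⟨mem_liouvilleSet.2 ⟨⟨by omega, by nlinarith, ?_, by nlinarith⟩, ?_, ?_, ?_⟩, ?_⟩
  · have : v * (2 * x) < z + x := lt_of_le_of_ne hv1 hne
    nlinarith
  · rw [show t + 2 * v * y + y = (y + t) + 2 * (v * y) by ring]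
    exact ho2.add_even (even_two_mul _)
  · rw [show x + (z - 2 * v * x) = (z + x) - 2 * (v * x) by ring]
    exact ho1.sub_even (even_two_mul _)
  · rw [← h]; ring
  · simp only [liouvilleMap, hv', Prod.mk.injEq, true_and]
    constructor <;> ring

lemma sum_liouvilleSet {n : ℤ} (hn : Odd n) :
    ∑ w ∈ liouvilleSet n,
      ZMod.χ₄ ((w.2.1 + w.1 : ℤ) : ZMod 4) * ZMod.χ₄ ((w.2.1 - w.1 : ℤ) : ZMod 4) = 0 := by
  have key : ∀ w ∈ liouvilleSet n,
      ZMod.χ₄ ((w.2.1 + w.1 : ℤ) : ZMod 4) * ZMod.χ₄ ((w.2.1 - w.1 : ℤ) : ZMod 4) =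
        if Even w.1 then 1 else -1 := by
    rintro ⟨x, z, y, t⟩ hw
    exact chi_four_add_mul_chi_four_sub (mem_liouvilleSet.1 hw).2.1
  have hflip : ∀ w ∈ liouvilleSet n, (Even w.1 ↔ ¬ Even (liouvilleMap w).1) := by
    rintro ⟨x, z, y, t⟩ hw
    exact even_iff_of_mem_liouvilleSet hn hw
  rw [Finset.sum_congr rfl key]
  refine Finset.sum_involution (fun w _ => liouvilleMap w) ?_ ?_ ?_ ?_
  · intro w hw
    have := hflip w hw
    split_ifs <;> first | (exfalso; tauto) | norm_num
  · intro w hw _ he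
    have := hflip w hw
    rw [he] at this; tauto
  · exact fun w hw => (liouvilleMap_mem hw).1
  · exact fun w hw => (liouvilleMap_mem hw).2

/-- The quadruples of odd positive integers with `ab + ce = 2n`. -/
def oddQuadruples (n : ℕ) : Finset (ℕ × ℕ × ℕ × ℕ) :=
  (Finset.range (2 * n + 1) ×ˢ Finset.range (2 * n + 1) ×ˢ Finset.range (2 * n + 1) ×ˢ
    Finset.range (2 * n + 1)).filter fun w =>
      (Odd w.1 ∧ Odd w.2.1 ∧ Odd w.2.2.1 ∧ Odd w.2.2.2) ∧ w.1 * w.2.1 + w.2.2.1 * w.2.2.2 = 2 * n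

lemma mem_oddQuadruples {n a b c e : ℕ} :
    (a, b, c, e) ∈ oddQuadruples n ↔
      (Odd a ∧ Odd b ∧ Odd c ∧ Odd e) ∧ a * b + c * e = 2 * n := by
  simp only [oddQuadruples, Finset.mem_filter, Finset.mem_product, Finset.mem_range,
    and_iff_right_iff_imp]
  rintro ⟨⟨ha, hb, hc, he⟩, h⟩
  have := Nat.le_mul_of_pos_right a hb.pos
  have := Nat.le_mul_of_pos_left b ha.pos
  have := Nat.le_mul_of_pos_right c he.pos
  have := Nat.le_mul_of_pos_left e hc.pos
  omega

lemma sum_oddQuadruples_gt {n : ℕ} (hn : Odd n) :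
    ∑ w ∈ (oddQuadruples n).filter (fun w => w.2.2.1 < w.1),
      ZMod.χ₄ (w.1 : ZMod 4) * ZMod.χ₄ (w.2.2.1 : ZMod 4) = 0 := by
  rw [← sum_liouvilleSet (n := n) (by exact_mod_cast hn)]
  symm
  refine Finset.sum_nbij'
    (fun w => ((w.2.1 + w.1).toNat, (w.2.2.1 + w.2.2.2).toNat, (w.2.1 - w.1).toNat,
      (w.2.2.1 - w.2.2.2).toNat))
    (fun w => (((w.1 : ℤ) - w.2.2.1) / 2, ((w.1 : ℤ) + w.2.2.1) / 2,
      ((w.2.1 : ℤ) + w.2.2.2) / 2, ((w.2.1 : ℤ) - w.2.2.2) / 2)) ?_ ?_ ?_ ?_ ?_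
  · rintro ⟨x, z, y, t⟩ hw
    obtain ⟨⟨hx, hxz, hty, hty'⟩, ho1, ho2, h⟩ := mem_liouvilleSet.1 hw
    rw [Finset.mem_filter, mem_oddQuadruples]
    rw [Int.odd_iff] at ho1 ho2
    simp only [Nat.odd_iff]
    refine ⟨⟨by omega, ?_⟩, by omega⟩
    zify
    rw [Int.toNat_of_nonneg (by omega), Int.toNat_of_nonneg (by omega),
      Int.toNat_of_nonneg (by omega), Int.toNat_of_nonneg (by omega), ← h]
    ring
  · rintro ⟨a, b, c, e⟩ hw
    rw [Finset.mem_filter, mem_oddQuadruples] at hw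
    obtain ⟨⟨ho, h⟩, hlt⟩ := hw
    dsimp only at hlt ⊢
    rw [mem_liouvilleSet]
    simp only [Nat.odd_iff, Int.odd_iff] at *
    refine ⟨by omega, by omega, by omega, ?_⟩
    obtain ⟨x, hx⟩ : ∃ x, (a : ℤ) - c = 2 * x := ⟨((a : ℤ) - c) / 2, by omega⟩
    obtain ⟨y, hy⟩ : ∃ y, (b : ℤ) + e = 2 * y := ⟨((b : ℤ) + e) / 2, by omega⟩
    rw [show (a : ℤ) + c = 2 * (x + c) by omega, show (b : ℤ) - e = 2 * (y - e) by omega, hx, hy]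
    simp only [Int.mul_ediv_cancel_left _ (two_ne_zero' ℤ)]
    zify at h
    have ha : (a : ℤ) = 2 * x + c := by omega
    have hb : (b : ℤ) = 2 * y - e := by omega
    rw [ha, hb] at h
    linarith
  · rintro ⟨x, z, y, t⟩ hw
    obtain ⟨⟨hx, hxz, hty, hty'⟩, -⟩ := mem_liouvilleSet.1 hw
    simp only [Prod.mk.injEq]
    omega
  · rintro ⟨a, b, c, e⟩ hw
    rw [Finset.mem_filter, mem_oddQuadruples] at hw
    obtain ⟨⟨ho, h⟩, hlt⟩ := hw
    simp only [Nat.odd_iff] at *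
    simp only [Prod.mk.injEq]
    omega
  · rintro ⟨x, z, y, t⟩ hw
    obtain ⟨⟨hx, hxz, hty, hty'⟩, -⟩ := mem_liouvilleSet.1 hw
    dsimp only
    rw [← Int.cast_natCast (Int.toNat _), ← Int.cast_natCast (Int.toNat (z - x)),
      Int.toNat_of_nonneg (by omega), Int.toNat_of_nonneg (by omega)]

lemma sum_oddQuadruples_lt {n : ℕ} (hn : Odd n) :
    ∑ w ∈ (oddQuadruples n).filter (fun w => w.1 < w.2.2.1),
      ZMod.χ₄ (w.1 : ZMod 4) * ZMod.χ₄ (w.2.2.1 : ZMod 4) = 0 := by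
  rw [← sum_oddQuadruples_gt hn]
  refine Finset.sum_nbij' (fun w => (w.2.2.1, w.2.2.2, w.1, w.2.1))
    (fun w => (w.2.2.1, w.2.2.2, w.1, w.2.1)) ?_ ?_ (fun _ _ => rfl) (fun _ _ => rfl)
    fun _ _ => mul_comm _ _
  all_goals
    rintro ⟨a, b, c, e⟩ hw
    rw [Finset.mem_filter, mem_oddQuadruples] at *
    obtain ⟨⟨⟨h1, h2, h3, h4⟩, h⟩, hlt⟩ := hw
    exact ⟨⟨⟨h3, h4, h1, h2⟩, by dsimp only; omega⟩, hlt⟩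

lemma le_sum_oddQuadruples {n : ℕ} (hn : Odd n) :
    (n : ℤ) ≤ ∑ w ∈ oddQuadruples n, ZMod.χ₄ (w.1 : ZMod 4) * ZMod.χ₄ (w.2.2.1 : ZMod 4) := by
  classical
  have hsplit : ∑ w ∈ oddQuadruples n, ZMod.χ₄ (w.1 : ZMod 4) * ZMod.χ₄ (w.2.2.1 : ZMod 4) =
      ∑ w ∈ (oddQuadruples n).filter (fun w => w.1 = w.2.2.1),
        ZMod.χ₄ (w.1 : ZMod 4) * ZMod.χ₄ (w.2.2.1 : ZMod 4) := by
    have h1 := sum_oddQuadruples_lt hn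
    have h2 := sum_oddQuadruples_gt hn
    have h3 : ∑ w ∈ oddQuadruples n, ZMod.χ₄ (w.1 : ZMod 4) * ZMod.χ₄ (w.2.2.1 : ZMod 4) =
        ∑ w ∈ (oddQuadruples n).filter (fun w => w.1 = w.2.2.1),
          ZMod.χ₄ (w.1 : ZMod 4) * ZMod.χ₄ (w.2.2.1 : ZMod 4) +
        ∑ w ∈ (oddQuadruples n).filter (fun w => w.1 < w.2.2.1),
          ZMod.χ₄ (w.1 : ZMod 4) * ZMod.χ₄ (w.2.2.1 : ZMod 4) +
        ∑ w ∈ (oddQuadruples n).filter (fun w => w.2.2.1 < w.1),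
          ZMod.χ₄ (w.1 : ZMod 4) * ZMod.χ₄ (w.2.2.1 : ZMod 4) := by
      simp only [Finset.sum_filter]
      rw [← Finset.sum_add_distrib, ← Finset.sum_add_distrib]
      refine Finset.sum_congr rfl fun w _ => ?_
      rcases lt_trichotomy w.1 w.2.2.1 with h | h | h
      · rw [if_neg h.ne, if_pos h, if_neg h.not_gt, zero_add, add_zero]
      · rw [if_pos h, if_neg h.not_lt, if_neg h.symm.not_lt, add_zero, add_zero]
      · rw [if_neg h.ne', if_neg h.not_gt, if_pos h, zero_add, zero_add]
    rw [h3, h1, h2, add_zero, add_zero]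
  rw [hsplit]
  set S := (Finset.range n).image fun j => (1, 2 * j + 1, 1, 2 * n - (2 * j + 1)) with hS
  have hcard : S.card = n := by
    rw [hS, Finset.card_image_of_injective, Finset.card_range]
    intro i j hij
    simp only [Prod.mk.injEq] at hij; omega
  calc (n : ℤ) = ∑ w ∈ S, 1 := by simp [hcard]
    _ = ∑ w ∈ S, ZMod.χ₄ (w.1 : ZMod 4) * ZMod.χ₄ (w.2.2.1 : ZMod 4) := by
        refine Finset.sum_congr rfl fun w hw => ?_
        obtain ⟨j, -, rfl⟩ := Finset.mem_image.1 hw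
        simp
    _ ≤ _ := by
        refine Finset.sum_le_sum_of_subset_of_nonneg ?_ ?_
        · intro w hw
          obtain ⟨j, hj, rfl⟩ := Finset.mem_image.1 hw
          rw [Finset.mem_range] at hj
          rw [Finset.mem_filter, mem_oddQuadruples]
          refine ⟨⟨⟨odd_one, ⟨j, rfl⟩, odd_one, Nat.odd_iff.2 (by omega)⟩, ?_⟩, rfl⟩
          rw [one_mul, one_mul]; omega
        · intro w hw _
          rw [(Finset.mem_filter.1 hw).2]
          exact mul_self_nonneg _

/-- Liouville's convolution inequality. -/
lemma le_sum_divisorSumChiFour_mul {n : ℕ} (hn : Odd n) :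
    (n : ℤ) ≤ ∑ r ∈ (Finset.range (2 * n)).filter Odd,
      divisorSumChiFour r * divisorSumChiFour (2 * n - r) := by
  refine (le_sum_oddQuadruples hn).trans (le_of_eq ?_)
  have hA : ∀ r, divisorSumChiFour r =
      ∑ p ∈ r.divisorsAntidiagonal, ZMod.χ₄ (p.1 : ZMod 4) := fun r => by
    rw [divisorSumChiFour_apply,
      Nat.sum_divisorsAntidiagonal (f := fun a _ => ZMod.χ₄ (a : ZMod 4))]
  simp_rw [hA, Finset.sum_mul_sum, ← Finset.sum_product']
  rw [Finset.sum_sigma']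
  refine Finset.sum_nbij' (fun w => ⟨w.1 * w.2.1, ((w.1, w.2.1), (w.2.2.1, w.2.2.2))⟩)
    (fun s => (s.2.1.1, s.2.1.2, s.2.2.1, s.2.2.2)) ?_ ?_ ?_ ?_ ?_
  · rintro ⟨a, b, c, e⟩ hw
    rw [mem_oddQuadruples] at hw
    obtain ⟨⟨h1, h2, h3, h4⟩, h⟩ := hw
    have hce : 0 < c * e := Nat.mul_pos h3.pos h4.pos
    have hab : 0 < a * b := Nat.mul_pos h1.pos h2.pos
    simp only [Finset.mem_sigma, Finset.mem_filter, Finset.mem_range, Finset.mem_product,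
      Nat.mem_divisorsAntidiagonal]
    exact ⟨⟨by omega, h1.mul h2⟩, ⟨trivial, hab.ne'⟩, by omega, by omega⟩
  · rintro ⟨r, ⟨a, b⟩, ⟨c, e⟩⟩ hw
    simp only [Finset.mem_sigma, Finset.mem_filter, Finset.mem_range, Finset.mem_product,
      Nat.mem_divisorsAntidiagonal] at hw
    obtain ⟨⟨hr, hro⟩, ⟨hab, -⟩, hce, -⟩ := hw
    rw [mem_oddQuadruples]
    have h2 : Odd (c * e) := by
      rw [hce, Nat.odd_iff]; rw [Nat.odd_iff] at hro; omega
    rw [← hab, Nat.odd_mul] at hro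
    rw [Nat.odd_mul] at h2
    exact ⟨⟨hro.1, hro.2, h2.1, h2.2⟩, by dsimp only; omega⟩
  · rintro ⟨a, b, c, e⟩ _; rfl
  · rintro ⟨r, ⟨a, b⟩, ⟨c, e⟩⟩ hw
    simp only [Finset.mem_sigma, Finset.mem_product, Nat.mem_divisorsAntidiagonal] at hw
    obtain ⟨-, ⟨hab, -⟩, -⟩ := hw
    subst hab; rfl
  · rintro ⟨a, b, c, e⟩ _; rfl

lemma mem_cube {d Y : ℕ} {u : Fin d → ℤ} : u ∈ cube d Y ↔ ∀ i, |u i| < Y := by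
  simp [cube, Fintype.mem_piFinset, abs_lt]

lemma mem_cube_of_sum_sq_le {d : ℕ} {u : Fin d → ℤ} {n : ℕ} (h : ∑ i, u i ^ 2 ≤ (n : ℤ)) :
    u ∈ cube d (n.sqrt + 1) := by
  rw [mem_cube]
  intro i
  refine abs_lt_of_sq_lt_sq ?_ (by positivity)
  have h1 : u i ^ 2 ≤ ∑ i, u i ^ 2 :=
    Finset.single_le_sum (f := fun i => u i ^ 2) (fun _ _ => sq_nonneg _) (Finset.mem_univ i)
  have h2 : (n : ℤ) < ((n.sqrt + 1 : ℕ) : ℤ) ^ 2 := by exact_mod_cast Nat.lt_succ_sqrt' n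
  linarith

lemma fst_mem_cube {d lam : ℕ} {uv : V d × V d} (h : uv ∈ sph d lam) :
    uv.1 ∈ cube d (lam.sqrt + 1) := by
  have h' : (∑ i, uv.1 i ^ 2) + (∑ i, uv.2 i ^ 2) = (lam : ℤ) := h
  have : 0 ≤ ∑ i, uv.2 i ^ 2 := Finset.sum_nonneg fun _ _ => sq_nonneg _
  exact mem_cube_of_sum_sq_le (by linarith)

lemma swap_mem_sph {d lam : ℕ} {uv : V d × V d} (h : uv ∈ sph d lam) : uv.swap ∈ sph d lam := by
  have h' : (∑ i, uv.1 i ^ 2) + (∑ i, uv.2 i ^ 2) = (lam : ℤ) := h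
  change (∑ i, uv.2 i ^ 2) + (∑ i, uv.1 i ^ 2) = (lam : ℤ)
  rw [add_comm, h']

lemma sph_finite (d lam : ℕ) : (sph d lam).Finite :=
  (cube d (lam.sqrt + 1) ×ˢ cube d (lam.sqrt + 1)).finite_toSet.subset fun _ h =>
    Finset.mem_coe.2 (Finset.mem_product.2 ⟨fst_mem_cube h, fst_mem_cube (swap_mem_sph h)⟩)

lemma le_Ncount_two {n : ℕ} (hn : Odd n) : n ≤ Ncount 2 n := by
  classical
  have hfam : ∀ r : ℕ, ∃ s : Finset (ℤ × ℤ), Odd r →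
      (∀ z ∈ s, z.1 ^ 2 + z.2 ^ 2 = r ∧ Odd z.1 ∧ Even z.2) ∧ divisorSumChiFour r ≤ s.card := by
    intro r
    by_cases hr : Odd r
    · obtain ⟨s, hs, hc⟩ := exists_odd_sq_add_sq_family hr
      refine ⟨s, fun _ => ⟨fun z hz => ⟨(hs z hz).1, (hs z hz).2, ?_⟩, hc⟩⟩
      have h1 : Odd (z.1 ^ 2 + z.2 ^ 2) := by rw [(hs z hz).1]; exact_mod_cast hr
      have h2 := (Int.odd_add.1 h1).1 (hs z hz).2.pow
      exact (Int.even_pow' two_ne_zero).1 h2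
    · exact ⟨∅, fun h => (hr h).elim⟩
  choose s hs using hfam
  have hodd : ∀ r ∈ (Finset.range (2 * n)).filter Odd, Odd r ∧ Odd (2 * n - r) := by
    intro r hr
    simp only [Finset.mem_filter, Finset.mem_range, Nat.odd_iff] at *
    omega
  set S : Finset (Σ _ : ℕ, (ℤ × ℤ) × (ℤ × ℤ)) :=
    ((Finset.range (2 * n)).filter Odd).sigma fun r => s r ×ˢ s (2 * n - r) with hS
  have hcard : (n : ℤ) ≤ S.card := by
    refine (le_sum_divisorSumChiFour_mul hn).trans ?_
    rw [hS, Finset.card_sigma]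
    push_cast
    refine Finset.sum_le_sum fun r hr => ?_
    rw [Finset.card_product]; push_cast
    exact mul_le_mul ((hs r) (hodd r hr).1).2 ((hs _) (hodd r hr).2).2
      (exists_isNormFamily _).1 (by positivity)
  let φ : (Σ _ : ℕ, (ℤ × ℤ) × (ℤ × ℤ)) → V 2 × V 2 := fun x =>
    (![(x.2.1.1 + x.2.2.1) / 2, (x.2.1.1 - x.2.2.1) / 2],
      ![(x.2.1.2 + x.2.2.2) / 2, (x.2.1.2 - x.2.2.2) / 2])
  have hmem : ∀ x ∈ S, x.2.1.1 ^ 2 + x.2.1.2 ^ 2 = (x.1 : ℤ) ∧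
      x.2.2.1 ^ 2 + x.2.2.2 ^ 2 = 2 * (n : ℤ) - x.1 ∧ Odd x.2.1.1 ∧ Even x.2.1.2 ∧
      Odd x.2.2.1 ∧ Even x.2.2.2 := by
    rintro ⟨r, z, w⟩ hx
    rw [hS, Finset.mem_sigma, Finset.mem_product] at hx
    obtain ⟨hr, hz, hw⟩ := hx
    obtain ⟨ho1, ho2⟩ := hodd r hr
    obtain ⟨h1, h2, h3⟩ := (hs r ho1).1 z hz
    obtain ⟨h4, h5, h6⟩ := (hs _ ho2).1 w hw
    have hlt := Finset.mem_range.1 (Finset.mem_filter.1 hr).1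
    dsimp only at hlt
    refine ⟨h1, ?_, h2, h3, h5, h6⟩
    rw [h4, Nat.cast_sub hlt.le]; push_cast; rfl
  have hsub : ((S.image φ : Finset (V 2 × V 2)) : Set (V 2 × V 2)) ⊆ sph 2 n := by
    intro y hy
    obtain ⟨⟨r, ⟨a, b⟩, ⟨c, e⟩⟩, hx, rfl⟩ := Finset.mem_image.1 (Finset.mem_coe.1 hy)
    obtain ⟨h1, h2, ⟨a', ha⟩, ⟨b', hb⟩, ⟨c', hc⟩, ⟨e', he⟩⟩ := hmem _ hx
    dsimp only at h1 h2 ha hb hc he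
    subst ha hb hc he
    change (∑ i : Fin 2, (![_, _] : V 2) i ^ 2) + (∑ i : Fin 2, (![_, _] : V 2) i ^ 2) = (n : ℤ)
    simp only [Fin.sum_univ_two, Matrix.cons_val_zero, Matrix.cons_val_one]
    rw [show (2 * a' + 1 + (2 * c' + 1)) / 2 = a' + c' + 1 by omega,
      show (2 * a' + 1 - (2 * c' + 1)) / 2 = a' - c' by omega,
      show (b' + b' + (e' + e')) / 2 = b' + e' by omega,
      show (b' + b' - (e' + e')) / 2 = b' - e' by omega]
    linarith
  have hinj : Set.InjOn φ S := by
    rintro ⟨r, ⟨a, b⟩, ⟨c, e⟩⟩ hx ⟨r', ⟨a', b'⟩, ⟨c', e'⟩⟩ hx' hxx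
    obtain ⟨h1, -, h3, h4, h5, h6⟩ := hmem _ hx
    obtain ⟨h1', -, h3', h4', h5', h6'⟩ := hmem _ hx'
    simp only [φ, Prod.mk.injEq] at hxx
    obtain ⟨hu, hv⟩ := hxx
    have hu0 := congrFun hu 0
    have hu1 := congrFun hu 1
    have hv0 := congrFun hv 0
    have hv1 := congrFun hv 1
    simp only [Matrix.cons_val_zero, Matrix.cons_val_one, Int.odd_iff, Int.even_iff] at *
    have ha : a = a' := by omega
    have hb : b = b' := by omega
    have hc : c = c' := by omega
    have he : e = e' := by omega
    subst ha hb hc he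
    have hr : r = r' := by exact_mod_cast h1.symm.trans h1'
    rw [hr]
  have h := Set.ncard_le_ncard hsub (sph_finite 2 n)
  rw [Set.ncard_coe_finset, Finset.card_image_of_injOn hinj] at h
  exact (by exact_mod_cast hcard : n ≤ S.card).trans h

/-- Splitting off one coordinate of each variable. -/
lemma sum_Ncount_le {ι : Type*} [Fintype ι] {d n : ℕ} (x y : ι → ℤ)
    (hinj : Function.Injective fun j => (x j, y j)) (m : ι → ℕ)
    (h : ∀ j, x j ^ 2 + y j ^ 2 + m j = n) : ∑ j, Ncount d (m j) ≤ Ncount (d + 1) n := by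
  have : ∀ m, Finite (sph d m) := fun m => (sph_finite d m).to_subtype
  have : Finite (sph (d + 1) n) := (sph_finite (d + 1) n).to_subtype
  unfold Ncount
  rw [← Nat.card_sigma]
  refine Nat.card_le_card_of_injective (β := sph (d + 1) n) (fun p =>
    ⟨(Fin.cons (x p.1) p.2.1.1, Fin.cons (y p.1) p.2.1.2), ?_⟩) ?_
  · obtain ⟨j, ⟨⟨u, v⟩, huv⟩⟩ := p
    have huv' : (∑ i, u i ^ 2) + (∑ i, v i ^ 2) = (m j : ℤ) := huv
    change (∑ i, (Fin.cons (x j) u : V (d + 1)) i ^ 2) +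
      (∑ i, (Fin.cons (y j) v : V (d + 1)) i ^ 2) = (n : ℤ)
    rw [Fin.sum_univ_succ, Fin.sum_univ_succ]
    simp only [Fin.cons_zero, Fin.cons_succ]
    rw [← h j, ← huv']; ring
  · rintro ⟨j, ⟨⟨u, v⟩, huv⟩⟩ ⟨j', ⟨⟨u', v'⟩, huv'⟩⟩ heq
    simp only [Subtype.mk.injEq, Prod.mk.injEq, Fin.cons_inj] at heq
    obtain ⟨⟨h1, h2⟩, h3, h4⟩ := heq
    have hj : j = j' := hinj (Prod.ext h1 h3)
    subst hj h2 h4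
    rfl

lemma exists_le_Ncount_succ {d : ℕ} {c : ℝ} (hc : 0 < c)
    (h : ∀ m : ℕ, Odd m → c * (m : ℝ) ^ (d - 1) ≤ Ncount d m) (hd : 1 ≤ d) :
    ∃ c' : ℝ, 0 < c' ∧ ∀ n : ℕ, 0 < n → c' * (n : ℝ) ^ d ≤ Ncount (d + 1) n := by
  refine ⟨c / 64 / 2 ^ (d - 1), by positivity, fun n hn => ?_⟩
  set s := (n / 64).sqrt with hs
  set ε : ℕ := if Odd n then 0 else 1 with hε
  have hs1 : s ^ 2 ≤ n / 64 := Nat.sqrt_le' _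
  have hs2 : n / 64 < (s + 1) ^ 2 := Nat.lt_succ_sqrt' _
  let x : Fin (s + 1) × Fin (s + 1) → ℕ := fun j => 2 * j.1 + ε
  let y : Fin (s + 1) × Fin (s + 1) → ℕ := fun j => 2 * j.2
  have hb : ∀ j, 2 * (x j ^ 2 + y j ^ 2) ≤ n := by
    intro j
    have h1 : (j.1 : ℕ) ≤ s := Nat.lt_succ_iff.1 j.1.2
    have h2 : (j.2 : ℕ) ≤ s := Nat.lt_succ_iff.1 j.2.2
    have hε1 : ε = 0 ∨ ε = 1 ∧ 2 ≤ n := by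
      by_cases ho : Odd n
      · simp [hε, ho]
      · right; rw [Nat.odd_iff] at ho; simp [hε, Nat.odd_iff, ho]; omega
    have hx : x j ≤ 2 * s + ε := by simp only [x]; omega
    have hy : y j ≤ 2 * s := by simp only [y]; omega
    have hx2 := Nat.pow_le_pow_left hx 2
    have hy2 := Nat.pow_le_pow_left hy 2
    have h64 : 64 * s ^ 2 ≤ n := by omega
    rcases hε1 with h0 | ⟨h0, h2n⟩
    · rw [h0] at hx2; nlinarith
    · rw [h0] at hx2
      rcases Nat.eq_zero_or_pos s with hs0 | hs0
      · rw [hs0] at hx2 hy2; omega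
      · nlinarith
  have hodd : ∀ j, Odd (n - (x j ^ 2 + y j ^ 2)) := by
    intro j
    have h1 : (x j ^ 2 + y j ^ 2) % 2 = ε % 2 := by
      have : x j ^ 2 + y j ^ 2 = 2 * (2 * j.1 ^ 2 + 2 * j.1 * ε + 2 * j.2 ^ 2) + ε ^ 2 := by
        simp only [x, y]; ring
      rw [this, Nat.mul_add_mod]
      by_cases ho : Odd n <;> simp [hε, ho]
    have := hb j
    by_cases ho : Odd n
    · simp only [hε, ho, if_true] at h1
      rw [Nat.odd_iff] at *; omega
    · simp only [hε, ho, if_false] at h1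
      rw [Nat.odd_iff] at *; omega
  have hsum := sum_Ncount_le (d := d) (n := n) (fun j => (x j : ℤ)) (fun j => (y j : ℤ)) (by
      intro i j hij
      simp only [Prod.mk.injEq, x, y] at hij
      refine Prod.ext (Fin.ext ?_) (Fin.ext ?_) <;> omega) (fun j => n - (x j ^ 2 + y j ^ 2)) (by
      intro j
      have := hb j
      push_cast [Nat.cast_sub (show x j ^ 2 + y j ^ 2 ≤ n by omega)]
      ring)
  have hterm : ∀ j, c * ((n : ℝ) / 2) ^ (d - 1) ≤ Ncount d (n - (x j ^ 2 + y j ^ 2)) := by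
    intro j
    refine le_trans ?_ (h _ (hodd j))
    gcongr
    have h1 := hb j
    have h2 : n ≤ 2 * (n - (x j ^ 2 + y j ^ 2)) := by omega
    have h3 : (n : ℝ) ≤ 2 * ((n - (x j ^ 2 + y j ^ 2) : ℕ) : ℝ) := by exact_mod_cast h2
    linarith
  have hn64 : (n : ℝ) / 64 ≤ ((s : ℝ) + 1) ^ 2 := by
    have : n ≤ 64 * (s + 1) ^ 2 := by omega
    have : (n : ℝ) ≤ 64 * ((s : ℝ) + 1) ^ 2 := by exact_mod_cast this
    linarith
  calc c / 64 / 2 ^ (d - 1) * (n : ℝ) ^ d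
      = (n / 64) * (c * ((n : ℝ) / 2) ^ (d - 1)) := by
        obtain ⟨k, rfl⟩ := Nat.exists_eq_add_of_le' hd
        simp only [Nat.add_sub_cancel, div_pow]
        field_simp
        ring
    _ ≤ ((s : ℝ) + 1) ^ 2 * (c * ((n : ℝ) / 2) ^ (d - 1)) := by gcongr
    _ = ∑ j : Fin (s + 1) × Fin (s + 1), c * ((n : ℝ) / 2) ^ (d - 1) := by
        simp only [Finset.sum_const, Finset.card_univ, Fintype.card_prod, Fintype.card_fin,
          nsmul_eq_mul]
        push_cast; ring
    _ ≤ ∑ j, (Ncount d (n - (x j ^ 2 + y j ^ 2)) : ℝ) := Finset.sum_le_sum fun j _ => hterm j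
    _ ≤ _ := by exact_mod_cast hsum

lemma exists_le_Ncount_odd (d : ℕ) (hd : 2 ≤ d) :
    ∃ c : ℝ, 0 < c ∧ ∀ n : ℕ, Odd n → c * (n : ℝ) ^ (d - 1) ≤ Ncount d n := by
  induction d, hd using Nat.le_induction with
  | base => exact ⟨1, one_pos, fun n hn => by simpa using le_Ncount_two hn⟩
  | succ d hd ih =>
    obtain ⟨c, hc, h⟩ := ih
    obtain ⟨c', hc', h'⟩ := exists_le_Ncount_succ hc h (by omega)
    exact ⟨c', hc', fun n hn => h' n hn.pos⟩

/-- Lower bound for the number of lattice points on spheres in dimension `2d ≥ 6`. -/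
theorem exists_le_Ncount (d : ℕ) (hd : 3 ≤ d) :
    ∃ c : ℝ, 0 < c ∧ ∀ n : ℕ, 0 < Ncount d n →
      c * ((n.sqrt + 1 : ℕ) : ℝ) ^ (2 * d - 2) ≤ Ncount d n := by
  obtain ⟨k, rfl⟩ := Nat.exists_eq_add_of_le' (show 1 ≤ d by omega)
  obtain ⟨c₀, hc₀, h₀⟩ := exists_le_Ncount_odd k (by omega)
  obtain ⟨c, hc, h⟩ := exists_le_Ncount_succ hc₀ h₀ (by omega)
  refine ⟨min 1 (c / 4 ^ k), by positivity, fun n hN => ?_⟩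
  rcases Nat.eq_zero_or_pos n with rfl | hn
  · have : (1 : ℝ) ≤ Ncount (k + 1) 0 := by exact_mod_cast hN
    simpa using Or.inl this
  · refine le_trans ?_ (h n hn)
    have h1 : (n.sqrt + 1) ^ 2 ≤ 4 * n := by
      have h2 := Nat.sqrt_le' n
      have h3 : 1 ≤ n.sqrt := Nat.sqrt_pos.2 hn
      nlinarith
    have h1' : (((n.sqrt + 1 : ℕ) : ℝ)) ^ 2 ≤ 4 * n := by exact_mod_cast h1
    calc min 1 (c / 4 ^ k) * ((n.sqrt + 1 : ℕ) : ℝ) ^ (2 * (k + 1) - 2)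
        ≤ c / 4 ^ k * (((n.sqrt + 1 : ℕ) : ℝ) ^ 2) ^ k := by
          rw [← pow_mul, show 2 * (k + 1) - 2 = 2 * k by omega]
          gcongr; exact min_le_right _ _
      _ ≤ c / 4 ^ k * (4 * n) ^ k := by gcongr
      _ = c * (n : ℝ) ^ k := by rw [mul_pow]; field_simp

/-- The discrete Hardy–Littlewood maximal function over cubes. -/
def cubeMax (d : ℕ) (F : V d → ℝ≥0∞) (x : V d) : ℝ≥0∞ :=
  ⨆ (Y : ℕ) (_ : 0 < Y), ((Y : ℝ≥0∞) ^ d)⁻¹ * ∑ u ∈ cube d Y, F (x - u)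

lemma card_cube_le (d Y : ℕ) : ((cube d Y).card : ℝ≥0∞) ≤ (2 * Y) ^ d := by
  have : (cube d Y).card ≤ (2 * Y) ^ d := by
    rw [cube, Fintype.card_piFinset]
    simp only [Int.card_Ioo, Finset.prod_const, Finset.card_univ, Fintype.card_fin]
    gcongr
    omega
  exact_mod_cast this

lemma tsum_ite_mem_cube_sub (d Y : ℕ) (b : V d) :
    ∑' x : V d, (if x - b ∈ cube d Y then 1 else 0 : ℝ≥0∞) = (cube d Y).card := by
  refine ((Equiv.subRight b).tsum_eq fun y => if y ∈ cube d Y then (1 : ℝ≥0∞) else 0).trans ?_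
  rw [tsum_eq_sum (s := cube d Y) fun y hy => if_neg hy]
  simp

lemma sum_cube_sub_eq_tsum (d Y : ℕ) (F : V d → ℝ≥0∞) (b : V d) :
    ∑ u ∈ cube d Y, F (b - u) = ∑' x, if b - x ∈ cube d Y then F x else 0 := by
  rw [← (Equiv.subLeft b).tsum_eq, tsum_eq_sum (s := cube d Y)]
  · refine Finset.sum_congr rfl fun u hu => ?_
    simp [hu]
  · intro u hu
    simp [hu]

lemma sub_mem_cube_comm {d Y : ℕ} {x y : V d} : x - y ∈ cube d Y ↔ y - x ∈ cube d Y := by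
  simp only [mem_cube, Pi.sub_apply, abs_sub_comm]

lemma cubeMax_add_le (d : ℕ) (F G : V d → ℝ≥0∞) (x : V d) :
    cubeMax d (fun y => F y + G y) x ≤ cubeMax d F x + cubeMax d G x := by
  refine iSup₂_le fun Y hY => ?_
  rw [Finset.sum_add_distrib, mul_add]
  exact add_le_add (le_iSup₂_of_le Y hY le_rfl) (le_iSup₂_of_le Y hY le_rfl)

lemma cubeMax_mono (d : ℕ) {F G : V d → ℝ≥0∞} (h : ∀ y, F y ≤ G y) (x : V d) :
    cubeMax d F x ≤ cubeMax d G x := by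
  refine iSup₂_mono fun Y hY => ?_
  gcongr
  exact h _

lemma cubeMax_const_le (d : ℕ) (c : ℝ≥0∞) (x : V d) : cubeMax d (fun _ => c) x ≤ 2 ^ d * c := by
  refine iSup₂_le fun Y hY => ?_
  have h0 : (Y : ℝ≥0∞) ^ d ≠ 0 := pow_ne_zero _ (by exact_mod_cast hY.ne')
  have ht : (Y : ℝ≥0∞) ^ d ≠ ∞ := by simp
  rw [Finset.sum_const, nsmul_eq_mul, ENNReal.inv_mul_le_iff h0 ht]
  calc ((cube d Y).card : ℝ≥0∞) * c ≤ (2 * Y) ^ d * c := by gcongr; exact card_cube_le d Y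
    _ = _ := by rw [mul_pow]; ring

/-- Weak type `(1,1)` bound for the maximal function. -/
lemma cubeMax_weak_type {d : ℕ} (hd : 1 ≤ d) (F : V d → ℝ≥0∞) {t : ℝ≥0∞} (ht : t ≠ 0) :
    t * ∑' x, (if t < cubeMax d F x then 1 else 0 : ℝ≥0∞) ≤ 10 ^ d * ∑' x, F x := by
  classical
  by_cases hS : ∑' x, F x = ∞
  · rw [hS, ENNReal.mul_top (by positivity)]; exact le_top
  set S := ∑' x, F x with hSdef
  have hY : ∀ x, ∃ Y : ℕ, t < cubeMax d F x →
      0 < Y ∧ t * (Y : ℝ≥0∞) ^ d ≤ ∑ u ∈ cube d Y, F (x - u) := by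
    intro x
    by_cases hx : t < cubeMax d F x
    · obtain ⟨Y, hY0, hY⟩ := by simpa only [cubeMax, lt_iSup_iff] using hx
      refine ⟨Y, fun _ => ⟨hY0, ?_⟩⟩
      have h0 : (Y : ℝ≥0∞) ^ d ≠ 0 := pow_ne_zero _ (by exact_mod_cast hY0.ne')
      rw [← ENNReal.le_div_iff_mul_le (Or.inl h0) (Or.inl (by simp)), ENNReal.div_eq_inv_mul]
      exact hY.le
    · exact ⟨0, fun h => (hx h).elim⟩
  choose Y hY using hY
  have hsumle : ∀ (Z : ℕ) b, ∑ u ∈ cube d Z, F (b - u) ≤ S := fun Z b => by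
    rw [sum_cube_sub_eq_tsum]
    exact ENNReal.tsum_le_tsum fun x => by split_ifs <;> simp
  obtain ⟨u, hut, hdisj, hcov⟩ := Vitali.exists_disjoint_subfamily_covering_enlargement_closedBall
    {x : V d | t < cubeMax d F x} (fun x => x) (fun x => (Y x : ℝ) - 1) (S / t).toReal
    (by
      intro x hx
      obtain ⟨h0, h1⟩ := hY x hx
      have h2 : (Y x : ℝ≥0∞) ≤ S / t := by
        rw [ENNReal.le_div_iff_mul_le (Or.inl ht) (Or.inr hS), mul_comm]
        refine le_trans ?_ (h1.trans (hsumle _ _))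
        gcongr
        exact_mod_cast Nat.le_self_pow (by omega) (Y x)
      have h3 := ENNReal.toReal_mono (ENNReal.div_ne_top hS ht) h2
      simp only [ENNReal.toReal_natCast] at h3
      linarith) 5 (by norm_num)
  have hball : ∀ (x b : V d) (Z : ℕ), 0 < Z →
      (x - b ∈ cube d Z → x ∈ Metric.closedBall b ((Z : ℝ) - 1)) := by
    intro x b Z hZ h
    rw [mem_cube] at h
    rw [Metric.mem_closedBall, dist_pi_le_iff (by
      have : (1 : ℝ) ≤ Z := by exact_mod_cast hZ
      linarith)]
    intro i
    have h1 : |x i - b i| ≤ (Z : ℤ) - 1 := by have := h i; simp only [Pi.sub_apply] at this; omega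
    rw [Int.dist_eq]
    exact_mod_cast h1
  have hcov' : ∀ x, t < cubeMax d F x → ∃ b ∈ u, x - b ∈ cube d (5 * Y b) := by
    intro x hx
    obtain ⟨b, hb, hsub⟩ := hcov x hx
    refine ⟨b, hb, ?_⟩
    have h1 := hsub (Metric.mem_closedBall_self (by
      have : (1 : ℝ) ≤ Y x := by exact_mod_cast (hY x hx).1
      linarith))
    rw [Metric.mem_closedBall] at h1
    rw [mem_cube]
    intro i
    have h2 := (dist_le_pi_dist x b i).trans h1
    rw [Int.dist_eq] at h2
    have h3 : (((|x i - b i| : ℤ)) : ℝ) < ((5 * Y b : ℕ) : ℤ) := by push_cast; linarith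
    exact_mod_cast h3
  have hone : ∀ x, ∑' b : u, (if (b : V d) - x ∈ cube d (Y b) then 1 else 0 : ℝ≥0∞) ≤ 1 := by
    intro x
    by_cases hex : ∃ b : u, (b : V d) - x ∈ cube d (Y b)
    · obtain ⟨b, hb⟩ := hex
      rw [tsum_eq_single b, if_pos hb]
      intro c hc
      rw [if_neg]
      intro hcx
      have hne : (c : V d) ≠ b := fun h => hc (Subtype.ext h)
      exact Set.disjoint_left.1 (hdisj c.2 b.2 hne)
        (hball x c _ (hY c (hut c.2)).1 (sub_mem_cube_comm.1 hcx))
        (hball x b _ (hY b (hut b.2)).1 (sub_mem_cube_comm.1 hb))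
    · push Not at hex
      simp [hex]
  calc t * ∑' x, (if t < cubeMax d F x then 1 else 0 : ℝ≥0∞)
      ≤ t * ∑' x, ∑' b : u, (if x - (b : V d) ∈ cube d (5 * Y b) then 1 else 0 : ℝ≥0∞) := by
        gcongr with x
        split_ifs with hx
        · obtain ⟨b, hb, hxb⟩ := hcov' x hx
          refine le_trans (le_of_eq ?_) (ENNReal.le_tsum ⟨b, hb⟩)
          rw [if_pos hxb]
        · exact zero_le
    _ = ∑' b : u, t * (cube d (5 * Y b)).card := by
        rw [ENNReal.tsum_comm, ← ENNReal.tsum_mul_left]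
        simp_rw [tsum_ite_mem_cube_sub]
    _ ≤ ∑' b : u, 10 ^ d * ∑ w ∈ cube d (Y b), F (b - w) := by
        refine ENNReal.tsum_le_tsum fun b => ?_
        calc t * ((cube d (5 * Y b)).card : ℝ≥0∞) ≤ t * (2 * (5 * Y b : ℕ)) ^ d := by
              gcongr; exact card_cube_le _ _
          _ = 10 ^ d * (t * (Y b : ℝ≥0∞) ^ d) := by
              push_cast
              rw [show (2 : ℝ≥0∞) * (5 * (Y b : ℝ≥0∞)) = 10 * Y b by rw [← mul_assoc]; norm_num,
                mul_pow]
              ring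
          _ ≤ _ := by gcongr; exact (hY b (hut b.2)).2
    _ = 10 ^ d * ∑' x, F x * ∑' b : u, (if (b : V d) - x ∈ cube d (Y b) then 1 else 0 : ℝ≥0∞) := by
        rw [ENNReal.tsum_mul_left]
        simp_rw [sum_cube_sub_eq_tsum, ← ENNReal.tsum_mul_left]
        rw [ENNReal.tsum_comm]
        simp
    _ ≤ 10 ^ d * ∑' x, F x := by
        gcongr with x
        exact (mul_le_mul_right (hone x) _).trans (by simp)

lemma exists_tsum_zpow_rpow_le {s : ℝ} (hs : 0 < s) :
    ∃ K : ℝ≥0, ∀ a : ℝ≥0∞,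
      ∑' k : ℤ, (if (2 : ℝ≥0∞) ^ k < a then ((2 : ℝ≥0∞) ^ k) ^ s else 0) ≤ K * a ^ s := by
  have hlt : ((2 : ℝ≥0∞) ^ s)⁻¹ < 1 := by
    rw [ENNReal.inv_lt_one]
    exact ENNReal.one_lt_rpow (by norm_num) hs
  have hK : (1 - ((2 : ℝ≥0∞) ^ s)⁻¹)⁻¹ ≠ ∞ := by
    rw [Ne, ENNReal.inv_eq_top, tsub_eq_zero_iff_le, not_le]
    exact hlt
  have hK0 : (1 - ((2 : ℝ≥0∞) ^ s)⁻¹)⁻¹ ≠ 0 := by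
    rw [Ne, ENNReal.inv_eq_zero]
    exact (tsub_le_self.trans_lt ENNReal.one_lt_top).ne
  refine ⟨((1 - ((2 : ℝ≥0∞) ^ s)⁻¹)⁻¹).toNNReal, fun a => ?_⟩
  rw [ENNReal.coe_toNNReal hK]
  rcases eq_or_ne a 0 with rfl | h0
  · simp
  rcases eq_or_ne a ∞ with rfl | ht
  · rw [ENNReal.top_rpow_of_pos hs, ENNReal.mul_top hK0]
    exact le_top
  obtain ⟨n, hn, hn'⟩ := ENNReal.exists_mem_Ioc_zpow h0 ht (y := 2) (by norm_num) (by simp)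
  calc ∑' k : ℤ, (if (2 : ℝ≥0∞) ^ k < a then ((2 : ℝ≥0∞) ^ k) ^ s else 0)
      ≤ ∑' k : ℤ, (if k ≤ n then ((2 : ℝ≥0∞) ^ k) ^ s else 0) := by
        refine ENNReal.tsum_le_tsum fun k => ?_
        by_cases hk : k ≤ n
        · rw [if_pos hk]; split_ifs <;> simp
        · rw [if_neg hk, if_neg]
          rw [not_lt]
          exact hn'.trans (ENNReal.zpow_le_of_le (by norm_num) (by omega))
    _ = ∑' j : ℤ, (if 0 ≤ j then ((2 : ℝ≥0∞) ^ (n - j)) ^ s else 0) := by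
        rw [← (Equiv.subLeft n).tsum_eq]
        refine tsum_congr fun j => ?_
        simp
    _ = ∑' j : ℕ, ((2 : ℝ≥0∞) ^ (n - (j : ℤ))) ^ s := by
        rw [← Function.Injective.tsum_eq (Nat.cast_injective (R := ℤ))]
        · simp
        · intro j hj
          by_cases h : 0 ≤ j
          · exact ⟨j.toNat, by simp [h]⟩
          · simp [h] at hj
    _ = ∑' j : ℕ, ((2 : ℝ≥0∞) ^ n) ^ s * (((2 : ℝ≥0∞) ^ s)⁻¹) ^ j := by
        refine tsum_congr fun j => ?_
        rw [ENNReal.zpow_sub (by simp) (by simp), ENNReal.mul_rpow_of_nonneg _ _ hs.le,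
          ENNReal.inv_rpow, zpow_natCast, ← ENNReal.inv_pow, ← ENNReal.rpow_natCast,
          ← ENNReal.rpow_natCast, ← ENNReal.rpow_mul, ← ENNReal.rpow_mul, mul_comm s]
    _ = (1 - ((2 : ℝ≥0∞) ^ s)⁻¹)⁻¹ * ((2 : ℝ≥0∞) ^ n) ^ s := by
        rw [ENNReal.tsum_mul_left, ENNReal.tsum_geometric, mul_comm]
    _ ≤ _ := by gcongr

lemma rpow_le_tsum_zpow {s : ℝ} (hs : 1 ≤ s) (a : ℝ≥0∞) :
    a ^ s ≤ ∑' k : ℤ, (2 * (2 : ℝ≥0∞) ^ k) ^ s * (if (2 : ℝ≥0∞) ^ k < a then 1 else 0) := by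
  have hs0 : 0 < s := by linarith
  rcases eq_or_ne a 0 with rfl | h0
  · simp [hs0]
  rcases eq_or_ne a ∞ with rfl | ht
  · refine le_of_eq_of_le (ENNReal.top_rpow_of_pos hs0) (top_le_iff.2 ?_)
    refine ENNReal.eq_top_of_forall_nnreal_le fun b => ?_
    obtain ⟨n, hn⟩ := exists_nat_ge b
    refine le_trans ?_ (ENNReal.le_tsum (n : ℤ))
    have h1 : (b : ℝ≥0∞) ≤ 2 * 2 ^ n := by
      have h2 : n ≤ 2 * 2 ^ n := by
        have := Nat.lt_two_pow_self (n := n)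
        omega
      calc (b : ℝ≥0∞) ≤ n := by exact_mod_cast hn
        _ ≤ _ := by exact_mod_cast h2
    have h3 : (1 : ℝ≥0∞) ≤ 2 * 2 ^ n := by
      exact_mod_cast Nat.mul_pos two_pos (Nat.two_pow_pos n)
    rw [zpow_natCast, if_pos (by simp [lt_top_iff_ne_top]), mul_one]
    calc (b : ℝ≥0∞) ≤ (2 * 2 ^ n) ^ (1 : ℝ) := by rwa [ENNReal.rpow_one]
      _ ≤ _ := ENNReal.rpow_le_rpow_of_exponent_le h3 hs
  obtain ⟨n, hn, hn'⟩ := ENNReal.exists_mem_Ioc_zpow h0 ht (y := 2) (by norm_num) (by simp)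
  refine le_trans ?_ (ENNReal.le_tsum n)
  rw [if_pos hn, mul_one]
  gcongr
  rwa [ENNReal.zpow_add (by simp) (by simp), zpow_one, mul_comm] at hn'

/-- The truncated weak type bound used in Marcinkiewicz interpolation. -/
lemma cubeMax_weak_type_truncated {d : ℕ} (hd : 1 ≤ d) (F : V d → ℝ≥0∞) {t : ℝ≥0∞}
    (ht : t ≠ 0) : t * ∑' x, (if t < cubeMax d F x then 1 else 0 : ℝ≥0∞) ≤
      2 * 10 ^ d * ∑' x, if t < 2 ^ (d + 1) * F x then F x else 0 := by
  set G : V d → ℝ≥0∞ := fun x => if t < 2 ^ (d + 1) * F x then F x else 0 with hG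
  have h2 : t / 2 ≠ 0 := by simp [ht]
  have hF : ∀ y, F y ≤ G y + t / 2 ^ (d + 1) := by
    intro y
    by_cases hy : t < 2 ^ (d + 1) * F y
    · simp [hG, hy]
    · have : F y ≤ t / 2 ^ (d + 1) := by
        rw [ENNReal.le_div_iff_mul_le (by simp) (by simp), mul_comm]
        exact not_lt.1 hy
      exact this.trans le_add_self
  have hM : ∀ x, cubeMax d F x ≤ cubeMax d G x + t / 2 := by
    intro x
    refine (cubeMax_mono d hF x).trans ((cubeMax_add_le d _ _ x).trans ?_)
    gcongr
    refine (cubeMax_const_le d _ x).trans (le_of_eq ?_)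
    rw [pow_succ, div_eq_mul_inv, ENNReal.mul_inv (by simp) (by simp), div_eq_mul_inv]
    calc (2 : ℝ≥0∞) ^ d * (t * ((2 ^ d)⁻¹ * 2⁻¹)) = ((2 : ℝ≥0∞) ^ d * (2 ^ d)⁻¹) * (t * 2⁻¹) := by
          ring
      _ = _ := by rw [ENNReal.mul_inv_cancel (by simp) (by simp), one_mul]
  calc t * ∑' x, (if t < cubeMax d F x then 1 else 0 : ℝ≥0∞)
      ≤ t * ∑' x, (if t / 2 < cubeMax d G x then 1 else 0 : ℝ≥0∞) := by
        gcongr with x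
        by_cases hx : t / 2 < cubeMax d G x
        · rw [if_pos hx]; split_ifs <;> simp
        · rw [if_neg hx, if_neg]
          rw [not_lt] at hx ⊢
          calc cubeMax d F x ≤ cubeMax d G x + t / 2 := hM x
            _ ≤ t / 2 + t / 2 := by gcongr
            _ = t := ENNReal.add_halves t
    _ = 2 * (t / 2 * ∑' x, (if t / 2 < cubeMax d G x then 1 else 0 : ℝ≥0∞)) := by
        rw [← mul_assoc, ENNReal.mul_div_cancel (by simp) (by simp)]
    _ ≤ 2 * (10 ^ d * ∑' x, G x) := mul_le_mul_right (cubeMax_weak_type hd G h2) _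
    _ = _ := by rw [mul_assoc]

/-- Strong type bound for the maximal function. -/
lemma exists_tsum_cubeMax_rpow_le {d : ℕ} (hd : 1 ≤ d) {s : ℝ} (hs : 1 < s) :
    ∃ C : ℝ≥0, ∀ F : V d → ℝ≥0∞, ∑' x, cubeMax d F x ^ s ≤ C * ∑' x, F x ^ s := by
  obtain ⟨K, hK⟩ := exists_tsum_zpow_rpow_le (sub_pos.2 hs)
  have hs0 : 0 ≤ s := by linarith
  have hs1 : 0 ≤ s - 1 := by linarith
  have hC : (2 : ℝ≥0∞) ^ s * (2 * 10 ^ d) * (K * (2 ^ (d + 1)) ^ (s - 1)) ≠ ∞ := by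
    have h1 : (2 : ℝ≥0∞) ^ s ≠ ∞ := ENNReal.rpow_ne_top_of_nonneg hs0 (by simp)
    have h2 : ((2 : ℝ≥0∞) ^ (d + 1)) ^ (s - 1) ≠ ∞ := ENNReal.rpow_ne_top_of_nonneg hs1 (by simp)
    have h3 : (2 * 10 ^ d : ℝ≥0∞) ≠ ∞ := ENNReal.mul_ne_top (by simp) (by simp)
    exact ENNReal.mul_ne_top (ENNReal.mul_ne_top h1 h3) (ENNReal.mul_ne_top (by simp) h2)
  refine ⟨(2 ^ s * (2 * 10 ^ d) * (K * (2 ^ (d + 1)) ^ (s - 1)) : ℝ≥0∞).toNNReal, fun F => ?_⟩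
  rw [ENNReal.coe_toNNReal hC]
  have hpow : ∀ a : ℝ≥0∞, a ^ s = a ^ (s - 1) * a := fun a => by
    conv_rhs => rw [← ENNReal.rpow_one a, ← ENNReal.rpow_mul, one_mul]
    rw [← ENNReal.rpow_add_of_nonneg _ _ hs1 zero_le_one, sub_add_cancel]
  calc ∑' x, cubeMax d F x ^ s
      ≤ ∑' x, ∑' k : ℤ, (2 * (2 : ℝ≥0∞) ^ k) ^ s *
          (if (2 : ℝ≥0∞) ^ k < cubeMax d F x then 1 else 0) :=
        ENNReal.tsum_le_tsum fun x => rpow_le_tsum_zpow hs.le _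
    _ = ∑' k : ℤ, (2 : ℝ≥0∞) ^ s * ((2 : ℝ≥0∞) ^ k) ^ (s - 1) *
          ((2 : ℝ≥0∞) ^ k * ∑' x, (if (2 : ℝ≥0∞) ^ k < cubeMax d F x then 1 else 0)) := by
        rw [ENNReal.tsum_comm]
        refine tsum_congr fun k => ?_
        rw [ENNReal.tsum_mul_left, ENNReal.mul_rpow_of_nonneg _ _ hs0, hpow ((2 : ℝ≥0∞) ^ k)]
        ring
    _ ≤ ∑' k : ℤ, (2 : ℝ≥0∞) ^ s * ((2 : ℝ≥0∞) ^ k) ^ (s - 1) *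
          (2 * 10 ^ d * ∑' x, if (2 : ℝ≥0∞) ^ k < 2 ^ (d + 1) * F x then F x else 0) := by
        refine ENNReal.tsum_le_tsum fun k => ?_
        refine mul_le_mul_right (cubeMax_weak_type_truncated hd F ?_) _
        exact (ENNReal.zpow_pos (by simp) (by simp) k).ne'
    _ = 2 ^ s * (2 * 10 ^ d) * ∑' x, F x * ∑' k : ℤ,
          (if (2 : ℝ≥0∞) ^ k < 2 ^ (d + 1) * F x then ((2 : ℝ≥0∞) ^ k) ^ (s - 1) else 0) := by
        simp_rw [← ENNReal.tsum_mul_left]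
        rw [ENNReal.tsum_comm]
        refine tsum_congr fun x => tsum_congr fun k => ?_
        split_ifs
        · ring
        · simp
    _ ≤ 2 ^ s * (2 * 10 ^ d) * ∑' x, F x * (K * (2 ^ (d + 1) * F x) ^ (s - 1)) := by
        gcongr with x
        exact hK _
    _ = _ := by
        rw [← ENNReal.tsum_mul_left, ← ENNReal.tsum_mul_left]
        refine tsum_congr fun x => ?_
        rw [ENNReal.mul_rpow_of_nonneg _ _ hs1, hpow (F x)]
        ring

lemma tsum_sph_eq_sum_cube (d lam : ℕ) (F : V d → ℝ≥0∞) :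
    ∑' uv : sph d lam, F uv.1.1 = ∑ u ∈ cube d (lam.sqrt + 1),
      (sphereCount d (lam.sqrt + 1) (lam - ∑ i, u i ^ 2) : ℝ≥0∞) * F u := by
  classical
  have hinner : ∀ u : V d,
      ∑' v : V d, (if (∑ i, u i ^ 2) + (∑ i, v i ^ 2) = (lam : ℤ) then F u else 0) =
        (sphereCount d (lam.sqrt + 1) (lam - ∑ i, u i ^ 2) : ℝ≥0∞) * F u := by
    intro u
    rw [tsum_eq_sum (s := (cube d (lam.sqrt + 1)).filter
      fun v => ∑ i, v i ^ 2 = (lam : ℤ) - ∑ i, u i ^ 2)]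
    · rw [Finset.sum_congr rfl (g := fun _ => F u), Finset.sum_const, nsmul_eq_mul, sphereCount]
      intro v hv
      rw [if_pos]
      have := (Finset.mem_filter.1 hv).2
      linarith
    · intro v hv
      rw [if_neg]
      intro h
      refine hv (Finset.mem_filter.2 ⟨fst_mem_cube (uv := (v, u))
          (swap_mem_sph (uv := (u, v)) h), ?_⟩)
      linarith
  calc ∑' uv : sph d lam, F uv.1.1
      = ∑' uv : V d × V d, (if (∑ i, uv.1 i ^ 2) + (∑ i, uv.2 i ^ 2) = (lam : ℤ)
          then F uv.1 else 0) := by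
        rw [tsum_subtype (sph d lam) fun uv => F uv.1]
        refine tsum_congr fun uv => ?_
        simp only [Set.indicator_apply, sph, Set.mem_ofPred_eq]
    _ = ∑' u : V d, (sphereCount d (lam.sqrt + 1) (lam - ∑ i, u i ^ 2) : ℝ≥0∞) * F u := by
        rw [ENNReal.tsum_prod']
        exact tsum_congr hinner
    _ = _ := by
        refine tsum_eq_sum fun u hu => ?_
        rw [sphereCount, Finset.filter_eq_empty_iff.2, Finset.card_empty, Nat.cast_zero, zero_mul]
        intro v _ hv
        exact hu (fst_mem_cube (uv := (u, v)) (by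
          change (∑ i, u i ^ 2) + (∑ i, v i ^ 2) = (lam : ℤ)
          linarith))

lemma exists_sphereCount_mul_le (d : ℕ) (hd : 5 ≤ d) :
    ∃ K : ℝ≥0, ∀ lam : ℕ, 0 < Ncount d lam → ∀ m : ℤ,
      (sphereCount d (lam.sqrt + 1) m : ℝ≥0∞) * ((lam.sqrt + 1 : ℕ) : ℝ≥0∞) ^ d ≤
        K * Ncount d lam := by
  obtain ⟨C, hC, h1⟩ := exists_sphereCount_le d hd
  obtain ⟨c, hc, h2⟩ := exists_le_Ncount d (by omega)
  refine ⟨⟨C / c, by positivity⟩, fun lam hlam m => ?_⟩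
  have key : (sphereCount d (lam.sqrt + 1) m : ℝ) * ((lam.sqrt + 1 : ℕ) : ℝ) ^ d ≤
      C / c * Ncount d lam := by
    set Y := lam.sqrt + 1
    calc (sphereCount d Y m : ℝ) * (Y : ℝ) ^ d ≤ C * (Y : ℝ) ^ (d - 2) * (Y : ℝ) ^ d := by
          gcongr; exact h1 Y (Nat.succ_pos _) m
      _ = C / c * (c * (Y : ℝ) ^ (2 * d - 2)) := by
          rw [mul_assoc, ← pow_add, show d - 2 + d = 2 * d - 2 by omega]
          field_simp
      _ ≤ _ := by gcongr; exact h2 lam hlam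
  have key' : (sphereCount d (lam.sqrt + 1) m : ℝ≥0) * ((lam.sqrt + 1 : ℕ) : ℝ≥0) ^ d ≤
      ⟨C / c, by positivity⟩ * Ncount d lam := by
    rw [← NNReal.coe_le_coe]
    push_cast at key ⊢
    exact key
  have := ENNReal.coe_le_coe.2 key'
  push_cast at this ⊢
  exact this

lemma exists_sum_sphereCount_sq_mul_le (d : ℕ) (hd : 3 ≤ d) :
    ∃ K : ℝ≥0, ∀ lam : ℕ, 0 < Ncount d lam →
      (∑ u ∈ cube d (lam.sqrt + 1),
        (sphereCount d (lam.sqrt + 1) (lam - ∑ i, u i ^ 2) : ℝ≥0∞) ^ 2) *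
          ((lam.sqrt + 1 : ℕ) : ℝ≥0∞) ^ d ≤ K * (Ncount d lam : ℝ≥0∞) ^ 2 := by
  obtain ⟨C, hC, h1⟩ := exists_sum_sphereCount_sq_le d hd
  obtain ⟨c, hc, h2⟩ := exists_le_Ncount d hd
  refine ⟨⟨C / c ^ 2, by positivity⟩, fun lam hlam => ?_⟩
  have key : (∑ u ∈ cube d (lam.sqrt + 1),
        (sphereCount d (lam.sqrt + 1) (lam - ∑ i, u i ^ 2) : ℝ) ^ 2) *
          ((lam.sqrt + 1 : ℕ) : ℝ) ^ d ≤ C / c ^ 2 * (Ncount d lam : ℝ) ^ 2 := by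
    set Y := lam.sqrt + 1
    calc (∑ u ∈ cube d Y, (sphereCount d Y (lam - ∑ i, u i ^ 2) : ℝ) ^ 2) * (Y : ℝ) ^ d
        ≤ C * (Y : ℝ) ^ (3 * d - 4) * (Y : ℝ) ^ d := by
          gcongr; exact h1 Y (Nat.succ_pos _) lam
      _ = C / c ^ 2 * (c * (Y : ℝ) ^ (2 * d - 2)) ^ 2 := by
          rw [mul_assoc, ← pow_add, mul_pow, ← pow_mul,
            show 3 * d - 4 + d = (2 * d - 2) * 2 by omega]
          field_simp
      _ ≤ _ := by gcongr; exact h2 lam hlam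
  have key' : (∑ u ∈ cube d (lam.sqrt + 1),
        (sphereCount d (lam.sqrt + 1) (lam - ∑ i, u i ^ 2) : ℝ≥0) ^ 2) *
          ((lam.sqrt + 1 : ℕ) : ℝ≥0) ^ d ≤
            ⟨C / c ^ 2, by positivity⟩ * (Ncount d lam : ℝ≥0) ^ 2 := by
    rw [← NNReal.coe_le_coe]
    push_cast at key ⊢
    exact key
  have := ENNReal.coe_le_coe.2 key'
  push_cast at this ⊢
  exact this

/-- The maximal function of the linear averages of `F` over the projection to the first factor of
the spheres in `ℤ^d × ℤ^d`. -/
def projMax (d : ℕ) (F : V d → ℝ≥0∞) (x : V d) : ℝ≥0∞ :=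
  ⨆ (lam : ℕ) (_ : 0 < Ncount d lam),
    (Ncount d lam : ℝ≥0∞)⁻¹ * ∑' uv : sph d lam, F (x - uv.1.1)

lemma exists_projMax_le (d : ℕ) (hd : 5 ≤ d) :
    ∃ K : ℝ≥0, ∀ F x, projMax d F x ≤ K * cubeMax d F x := by
  obtain ⟨K, hK⟩ := exists_sphereCount_mul_le d hd
  refine ⟨K, fun F x => iSup₂_le fun lam hlam => ?_⟩
  have hN : (Ncount d lam : ℝ≥0∞) ≠ 0 := by exact_mod_cast hlam.ne'
  set Y := lam.sqrt + 1
  have hY : ((Y : ℕ) : ℝ≥0∞) ^ d ≠ 0 := pow_ne_zero _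
      (by exact_mod_cast (Nat.succ_pos lam.sqrt).ne')
  rw [tsum_sph_eq_sum_cube d lam fun u => F (x - u)]
  calc (Ncount d lam : ℝ≥0∞)⁻¹ *
        ∑ u ∈ cube d Y, (sphereCount d Y (lam - ∑ i, u i ^ 2) : ℝ≥0∞) * F (x - u)
      ≤ (Ncount d lam : ℝ≥0∞)⁻¹ * ∑ u ∈ cube d Y,
          K * Ncount d lam / (Y : ℝ≥0∞) ^ d * F (x - u) := by
        gcongr with u
        rw [ENNReal.le_div_iff_mul_le (Or.inl hY) (Or.inl (by simp))]
        exact hK lam hlam _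
    _ = (Ncount d lam : ℝ≥0∞)⁻¹ * Ncount d lam *
          (K * (((Y : ℝ≥0∞) ^ d)⁻¹ * ∑ u ∈ cube d Y, F (x - u))) := by
        rw [← Finset.mul_sum, div_eq_mul_inv]
        ring
    _ = K * (((Y : ℝ≥0∞) ^ d)⁻¹ * ∑ u ∈ cube d Y, F (x - u)) := by
        rw [ENNReal.inv_mul_cancel hN (by simp), one_mul]
    _ ≤ _ := by
        gcongr
        exact le_iSup₂_of_le Y (Nat.succ_pos _) le_rfl

lemma sq_sum_mul_le {ι : Type*} (s : Finset ι) (f g : ι → ℝ≥0∞) :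
    (∑ i ∈ s, f i * g i) ^ 2 ≤ (∑ i ∈ s, f i ^ 2) * ∑ i ∈ s, g i ^ 2 := by
  have h := ENNReal.inner_le_Lp_mul_Lq s f g Real.HolderConjugate.two_two
  simp only [ENNReal.rpow_two] at h
  calc _ ≤ _ := pow_le_pow_left' h 2
    _ = _ := by
      rw [mul_pow, ← ENNReal.rpow_two, ← ENNReal.rpow_two, ← ENNReal.rpow_mul, ← ENNReal.rpow_mul]
      norm_num

lemma exists_projMax_sq_le (d : ℕ) (hd : 3 ≤ d) :
    ∃ K : ℝ≥0, ∀ F x, projMax d F x ≤ (K * cubeMax d (fun y => F y ^ 2) x) ^ (2⁻¹ : ℝ) := by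
  obtain ⟨K, hK⟩ := exists_sum_sphereCount_sq_mul_le d hd
  refine ⟨K, fun F x => iSup₂_le fun lam hlam => ?_⟩
  have hN : (Ncount d lam : ℝ≥0∞) ≠ 0 := by exact_mod_cast hlam.ne'
  set Y := lam.sqrt + 1
  have hY : ((Y : ℕ) : ℝ≥0∞) ^ d ≠ 0 := pow_ne_zero _
      (by exact_mod_cast (Nat.succ_pos lam.sqrt).ne')
  rw [ENNReal.le_rpow_inv_iff (by norm_num), ENNReal.rpow_two,
    tsum_sph_eq_sum_cube d lam fun u => F (x - u)]
  calc ((Ncount d lam : ℝ≥0∞)⁻¹ *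
        ∑ u ∈ cube d Y, (sphereCount d Y (lam - ∑ i, u i ^ 2) : ℝ≥0∞) * F (x - u)) ^ 2
      ≤ ((Ncount d lam : ℝ≥0∞)⁻¹) ^ 2 *
          ((∑ u ∈ cube d Y, (sphereCount d Y (lam - ∑ i, u i ^ 2) : ℝ≥0∞) ^ 2) *
            ∑ u ∈ cube d Y, F (x - u) ^ 2) := by
        rw [mul_pow]
        gcongr
        exact sq_sum_mul_le _ _ _
    _ ≤ ((Ncount d lam : ℝ≥0∞)⁻¹) ^ 2 * (K * (Ncount d lam : ℝ≥0∞) ^ 2 / (Y : ℝ≥0∞) ^ d *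
          ∑ u ∈ cube d Y, F (x - u) ^ 2) := by
        gcongr
        rw [ENNReal.le_div_iff_mul_le (Or.inl hY) (Or.inl (by simp))]
        exact hK lam hlam
    _ = ((Ncount d lam : ℝ≥0∞)⁻¹ * Ncount d lam) ^ 2 *
          (K * (((Y : ℝ≥0∞) ^ d)⁻¹ * ∑ u ∈ cube d Y, F (x - u) ^ 2)) := by
        rw [div_eq_mul_inv]
        ring
    _ = K * (((Y : ℝ≥0∞) ^ d)⁻¹ * ∑ u ∈ cube d Y, F (x - u) ^ 2) := by
        rw [ENNReal.inv_mul_cancel hN (by simp), one_pow, one_mul]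
    _ ≤ _ := by
        gcongr
        exact le_iSup₂_of_le Y (Nat.succ_pos _) le_rfl

lemma exists_tsum_projMax_rpow_le {d : ℕ} (hd : 3 ≤ d) {r : ℝ} (hr : (d : ℝ) / ((d : ℝ) - 2) < r) :
    ∃ C : ℝ≥0, ∀ F : V d → ℝ≥0∞, ∑' x, projMax d F x ^ r ≤ C * ∑' x, F x ^ r := by
  have hd' : (3 : ℝ) ≤ d := by exact_mod_cast hd
  rw [div_lt_iff₀ (by linarith)] at hr
  rcases le_or_gt 5 d with h5 | h5
  · have hr1 : 1 < r := by nlinarith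
    obtain ⟨K, hK⟩ := exists_projMax_le d h5
    obtain ⟨C, hC⟩ := exists_tsum_cubeMax_rpow_le (d := d) (by omega) hr1
    refine ⟨K ^ r * C, fun F => ?_⟩
    calc ∑' x, projMax d F x ^ r ≤ ∑' x, (K * cubeMax d F x) ^ r := by gcongr; exact hK _ _
      _ = (K : ℝ≥0∞) ^ r * ∑' x, cubeMax d F x ^ r := by
          simp_rw [ENNReal.mul_rpow_of_nonneg _ _ (by linarith : 0 ≤ r)]
          rw [ENNReal.tsum_mul_left]
      _ ≤ (K : ℝ≥0∞) ^ r * (C * ∑' x, F x ^ r) := by gcongr; exact hC F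
      _ = _ := by
          rw [ENNReal.coe_mul, ENNReal.coe_rpow_of_nonneg _ (by linarith : 0 ≤ r), mul_assoc]
  · have hr2 : 2 < r := by
      interval_cases d <;> norm_num at hr <;> linarith
    have hr1 : 1 < 2⁻¹ * r := by linarith
    obtain ⟨K, hK⟩ := exists_projMax_sq_le d hd
    obtain ⟨C, hC⟩ := exists_tsum_cubeMax_rpow_le (d := d) (by omega) hr1
    have h0 : 0 ≤ 2⁻¹ * r := by linarith
    refine ⟨K ^ (2⁻¹ * r) * C, fun F => ?_⟩
    calc ∑' x, projMax d F x ^ r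
        ≤ ∑' x, ((K * cubeMax d (fun y => F y ^ 2) x) ^ (2⁻¹ : ℝ)) ^ r := by gcongr; exact hK _ _
      _ = (K : ℝ≥0∞) ^ (2⁻¹ * r) * ∑' x, cubeMax d (fun y => F y ^ 2) x ^ (2⁻¹ * r) := by
          simp_rw [← ENNReal.rpow_mul, ENNReal.mul_rpow_of_nonneg _ _ h0]
          rw [ENNReal.tsum_mul_left]
      _ ≤ (K : ℝ≥0∞) ^ (2⁻¹ * r) * (C * ∑' x, (F x ^ 2) ^ (2⁻¹ * r)) := by gcongr; exact hC _
      _ = _ := by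
          simp_rw [← ENNReal.rpow_two, ← ENNReal.rpow_mul, ← mul_assoc]
          rw [ENNReal.coe_mul, ENNReal.coe_rpow_of_nonneg _ h0]
          norm_num

lemma tsum_sph_snd_eq (d lam : ℕ) (F : V d → ℝ≥0∞) :
    ∑' uv : sph d lam, F uv.1.2 = ∑' uv : sph d lam, F uv.1.1 :=
  let e : sph d lam ≃ sph d lam :=
    { toFun := fun uv => ⟨uv.1.swap, swap_mem_sph uv.2⟩
      invFun := fun uv => ⟨uv.1.swap, swap_mem_sph uv.2⟩
      left_inv := fun _ => rfl
      right_inv := fun _ => rfl }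
  e.tsum_eq fun uv : sph d lam => F uv.1.1

lemma maxOp_le_projMax_add {d : ℕ} {f g : V d → ℂ} {A B : V d → ℝ≥0∞}
    (h : ∀ y z, ‖f y‖ₑ * ‖g z‖ₑ ≤ A y + B z) (x : V d) :
    maxOp d f g x ≤ projMax d A x + projMax d B x := by
  refine iSup₂_le fun lam hlam => ?_
  have hN : (Ncount d lam : ℂ) ≠ 0 := by exact_mod_cast hlam.ne'
  change ‖avg d lam f g x‖ₑ ≤ _
  calc ‖avg d lam f g x‖ₑ
      ≤ (Ncount d lam : ℝ≥0∞)⁻¹ * ∑' uv : sph d lam, (A (x - uv.1.1) + B (x - uv.1.2)) := by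
        rw [avg, enorm_mul, enorm_inv hN]
        gcongr
        · simp [enorm_eq_nnnorm]
        · refine enorm_tsum_le_tsum_enorm.trans (ENNReal.tsum_le_tsum fun uv => ?_)
          rw [enorm_mul]
          exact h _ _
    _ = (Ncount d lam : ℝ≥0∞)⁻¹ * ∑' uv : sph d lam, A (x - uv.1.1) +
          (Ncount d lam : ℝ≥0∞)⁻¹ * ∑' uv : sph d lam, B (x - uv.1.1) := by
        rw [ENNReal.tsum_add, mul_add, tsum_sph_snd_eq d lam fun y => B (x - y)]
    _ ≤ _ := add_le_add (le_iSup₂_of_le lam hlam le_rfl) (le_iSup₂_of_le lam hlam le_rfl)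

lemma exists_lpNormE_maxOp_le {d : ℕ} (hd : 3 ≤ d) {r : ℝ} (hr : (d : ℝ) / ((d : ℝ) - 2) < r) :
    ∃ C : ℝ≥0, ∀ (f g : V d → ℂ) (A B : V d → ℝ≥0∞) (M : ℝ≥0∞),
      (∀ y z, ‖f y‖ₑ * ‖g z‖ₑ ≤ A y + B z) → ∑' x, A x ^ r ≤ M ^ r → ∑' x, B x ^ r ≤ M ^ r →
        lpNormE d r (maxOp d f g) ≤ C * M := by
  have hd' : (3 : ℝ) ≤ d := by exact_mod_cast hd
  have hr1 : 1 ≤ r := by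
    refine le_trans ?_ hr.le
    rw [one_le_div (by linarith)]
    linarith
  have hr0 : 0 < r := by linarith
  obtain ⟨C, hC⟩ := exists_tsum_projMax_rpow_le hd hr
  refine ⟨(2 ^ (r - 1) * (C + C)) ^ (1 / r), fun f g A B M h hA hB => ?_⟩
  rw [lpNormE, ENNReal.coe_rpow_of_nonneg _ (by positivity), ENNReal.coe_mul,
    ENNReal.coe_rpow_of_nonneg _ (by linarith), one_div, ENNReal.rpow_inv_le_iff hr0,
    ENNReal.mul_rpow_of_nonneg _ _ hr0.le, ENNReal.rpow_inv_rpow hr0.ne']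
  calc ∑' x, maxOp d f g x ^ r ≤ ∑' x, (projMax d A x + projMax d B x) ^ r := by
        gcongr; exact maxOp_le_projMax_add h _
    _ ≤ ∑' x, 2 ^ (r - 1) * (projMax d A x ^ r + projMax d B x ^ r) :=
        ENNReal.tsum_le_tsum fun x => ENNReal.rpow_add_le_mul_rpow_add_rpow _ _ hr1
    _ = 2 ^ (r - 1) * (∑' x, projMax d A x ^ r + ∑' x, projMax d B x ^ r) := by
        rw [ENNReal.tsum_mul_left, ENNReal.tsum_add]
    _ ≤ 2 ^ (r - 1) * (C * M ^ r + C * M ^ r) := by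
        gcongr
        · exact (hC A).trans (by gcongr)
        · exact (hC B).trans (by gcongr)
    _ = _ := by push_cast; ring

lemma eq_zero_of_lpNormC_eq_zero {d : ℕ} {p : ℝ≥0∞} (hp : 1 ≤ p) {f : V d → ℂ}
    (h : lpNormC d p f = 0) (x : V d) : ‖f x‖ₑ = 0 := by
  rw [lpNormC] at h
  split_ifs at h with hpt
  · exact ENNReal.iSup_eq_zero.1 h x
  · have hp0 : 0 < p.toReal := ENNReal.toReal_pos (zero_lt_one.trans_le hp).ne' hpt
    rw [lpNorm, ENNReal.rpow_eq_zero_iff_of_pos (by positivity), ENNReal.tsum_eq_zero] at h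
    exact (ENNReal.rpow_eq_zero_iff_of_pos hp0).1 (h x)

lemma tsum_div_lpNormC_rpow {d : ℕ} {p : ℝ≥0∞} (hp : 1 ≤ p) (hpt : p ≠ ∞) {f : V d → ℂ}
    (h0 : lpNormC d p f ≠ 0) (h1 : lpNormC d p f ≠ ∞) :
    ∑' x, (‖f x‖ₑ / lpNormC d p f) ^ p.toReal = 1 := by
  have hp0 : 0 < p.toReal := ENNReal.toReal_pos (zero_lt_one.trans_le hp).ne' hpt
  have hP : ∑' x, ‖f x‖ₑ ^ p.toReal = lpNormC d p f ^ p.toReal := by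
    rw [lpNormC, if_neg hpt, lpNorm, one_div, ENNReal.rpow_inv_rpow hp0.ne']
    rfl
  simp_rw [ENNReal.div_rpow_of_nonneg _ _ hp0.le, div_eq_mul_inv]
  rw [ENNReal.tsum_mul_right, hP]
  refine ENNReal.mul_inv_cancel ?_ (ENNReal.rpow_ne_top_of_nonneg hp0.le h1)
  rw [Ne, ENNReal.rpow_eq_zero_iff_of_pos hp0]
  exact h0

lemma div_lpNormC_le_one {d : ℕ} {p : ℝ≥0∞} (hp : 1 ≤ p) {f : V d → ℂ}
    (h0 : lpNormC d p f ≠ 0) (h1 : lpNormC d p f ≠ ∞) (x : V d) :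
    ‖f x‖ₑ / lpNormC d p f ≤ 1 := by
  by_cases hpt : p = ∞
  · refine ENNReal.div_le_of_le_mul ?_
    rw [one_mul, lpNormC, if_pos hpt]
    exact le_iSup (fun x => (‖f x‖₊ : ℝ≥0∞)) x
  · have hp0 : 0 < p.toReal := ENNReal.toReal_pos (zero_lt_one.trans_le hp).ne' hpt
    rw [← ENNReal.rpow_le_rpow_iff hp0, ENNReal.one_rpow, ← tsum_div_lpNormC_rpow hp hpt h0 h1]
    exact ENNReal.le_tsum (f := fun x => (‖f x‖ₑ / lpNormC d p f) ^ p.toReal) x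

lemma mul_le_rpow_div_add_rpow_div {p q : ℝ≥0∞} (hp : 1 ≤ p) (hq : 1 ≤ q) {r : ℝ} (hr : 0 < r)
    (hpqr : (ENNReal.ofReal r)⁻¹ ≤ p⁻¹ + q⁻¹) {a b : ℝ≥0∞} (ha : a ≤ 1) (hb : b ≤ 1) :
    a * b ≤ (if p = ∞ then 0 else a ^ (p.toReal / r)) +
        if q = ∞ then 0 else b ^ (q.toReal / r) := by
  have hself : ∀ {s : ℝ≥0∞} {c : ℝ≥0∞}, s ≠ ∞ → c ≤ 1 → (ENNReal.ofReal r)⁻¹ ≤ s⁻¹ →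
      c ≤ c ^ (s.toReal / r) := by
    intro s c hs hc h
    rw [ENNReal.inv_le_inv, ← ENNReal.toReal_le_toReal hs (by simp),
      ENNReal.toReal_ofReal hr.le] at h
    calc c = c ^ (1 : ℝ) := (ENNReal.rpow_one c).symm
      _ ≤ _ := ENNReal.rpow_le_rpow_of_exponent_ge hc ((div_le_one hr).2 h)
  by_cases hpt : p = ∞
  · by_cases hqt : q = ∞
    · simp [hpt, hqt] at hpqr
    · rw [if_pos hpt, if_neg hqt, zero_add]
      refine le_trans ?_ (hself hqt hb (by simpa [hpt] using hpqr))
      exact (mul_le_mul_left ha b).trans (one_mul b).le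
  by_cases hqt : q = ∞
  · rw [if_pos hqt, if_neg hpt, add_zero]
    refine le_trans ?_ (hself hpt ha (by simpa [hqt] using hpqr))
    exact (mul_le_mul_right hb a).trans (mul_one a).le
  rw [if_neg hpt, if_neg hqt]
  have hp0 : 0 < p.toReal := ENNReal.toReal_pos (zero_lt_one.trans_le hp).ne' hpt
  have hq0 : 0 < q.toReal := ENNReal.toReal_pos (zero_lt_one.trans_le hq).ne' hqt
  have hpq : r⁻¹ ≤ p.toReal⁻¹ + q.toReal⁻¹ := by
    have hpi : p⁻¹ ≠ ∞ := ENNReal.inv_ne_top.2 (zero_lt_one.trans_le hp).ne'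
    have hqi : q⁻¹ ≠ ∞ := ENNReal.inv_ne_top.2 (zero_lt_one.trans_le hq).ne'
    have := ENNReal.toReal_mono (ENNReal.add_ne_top.2 ⟨hpi, hqi⟩) hpqr
    rwa [ENNReal.toReal_add hpi hqi, ENNReal.toReal_inv, ENNReal.toReal_inv, ENNReal.toReal_inv,
      ENNReal.toReal_ofReal hr.le] at this
  set m := max (a ^ (p.toReal / r)) (b ^ (q.toReal / r)) with hm
  have hm1 : m ≤ 1 := max_le (ENNReal.rpow_le_one ha (by positivity))
    (ENNReal.rpow_le_one hb (by positivity))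
  have ha' : a ≤ m ^ (r / p.toReal) := by
    calc a = (a ^ (p.toReal / r)) ^ (r / p.toReal) := by
          rw [← ENNReal.rpow_mul, div_mul_div_cancel₀ hr.ne', div_self hp0.ne', ENNReal.rpow_one]
      _ ≤ _ := by gcongr; exact le_max_left _ _
  have hb' : b ≤ m ^ (r / q.toReal) := by
    calc b = (b ^ (q.toReal / r)) ^ (r / q.toReal) := by
          rw [← ENNReal.rpow_mul, div_mul_div_cancel₀ hr.ne', div_self hq0.ne', ENNReal.rpow_one]
      _ ≤ _ := by gcongr; exact le_max_right _ _
  calc a * b ≤ m ^ (r / p.toReal) * m ^ (r / q.toReal) := mul_le_mul' ha' hb'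
    _ = m ^ (r / p.toReal + r / q.toReal) :=
        (ENNReal.rpow_add_of_nonneg _ _ (by positivity) (by positivity)).symm
    _ ≤ m ^ (1 : ℝ) := by
        refine ENNReal.rpow_le_rpow_of_exponent_ge hm1 ?_
        calc (1 : ℝ) = r * r⁻¹ := (mul_inv_cancel₀ hr.ne').symm
          _ ≤ r * (p.toReal⁻¹ + q.toReal⁻¹) := by gcongr
          _ = _ := by ring
    _ = m := ENNReal.rpow_one m
    _ ≤ _ := max_le le_self_add le_add_self

lemma tsum_ite_div_lpNormC_rpow_le {d : ℕ} {p : ℝ≥0∞} (hp : 1 ≤ p) {r : ℝ} (hr : 0 < r)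
    {f : V d → ℂ} (h0 : lpNormC d p f ≠ 0) (h1 : lpNormC d p f ≠ ∞) (M : ℝ≥0∞) :
    ∑' x, (M * if p = ∞ then 0 else (‖f x‖ₑ / lpNormC d p f) ^ (p.toReal / r)) ^ r ≤ M ^ r := by
  simp_rw [ENNReal.mul_rpow_of_nonneg _ _ hr.le]
  rw [ENNReal.tsum_mul_left]
  refine (mul_le_mul_right ?_ _).trans (mul_one _).le
  split_ifs with hpt
  · simp [hr]
  · simp_rw [← ENNReal.rpow_mul, div_mul_cancel₀ _ hr.ne']
    exact (tsum_div_lpNormC_rpow hp hpt h0 h1).le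

/-- For `d ≥ 3`, `p, q ∈ [1,∞]` and `r > d/(d-2)` with `1/p + 1/q ≥ 1/r`,
the bilinear discrete spherical maximal operator is bounded from
`l^p(ℤ^d) × l^q(ℤ^d)` to `l^r(ℤ^d)`. -/
theorem bilinear_discrete_spherical_lp_lq_lr
    (d : ℕ) (hd : 3 ≤ d) (p q : ℝ≥0∞) (hp : 1 ≤ p) (hq : 1 ≤ q)
    (r : ℝ) (hr : (d : ℝ) / ((d : ℝ) - 2) < r)
    (hpqr : (ENNReal.ofReal r)⁻¹ ≤ p⁻¹ + q⁻¹) :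
    ∃ C : ℝ≥0, ∀ f g : V d → ℂ,
      lpNormE d r (maxOp d f g) ≤ C * lpNormC d p f * lpNormC d q g := by
  have hd' : (3 : ℝ) ≤ d := by exact_mod_cast hd
  have hr0 : 0 < r := (div_pos (by linarith) (by linarith)).trans hr
  obtain ⟨C, hC⟩ := exists_lpNormE_maxOp_le hd hr
  have hC1 : ((C + 1 : ℝ≥0) : ℝ≥0∞) ≠ 0 := by simp
  refine ⟨C + 1, fun f g => ?_⟩
  set P := lpNormC d p f with hP
  set Q := lpNormC d q g with hQ
  by_cases hz : P = 0 ∨ Q = 0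
  · have hfg : ∀ y z, ‖f y‖ₑ * ‖g z‖ₑ ≤ (0 : V d → ℝ≥0∞) y + (0 : V d → ℝ≥0∞) z := by
      intro y z
      rcases hz with h | h
      · simp [eq_zero_of_lpNormC_eq_zero hp h y]
      · simp [eq_zero_of_lpNormC_eq_zero hq h z]
    refine (hC f g 0 0 0 hfg (by simp [hr0]) (by simp [hr0])).trans ?_
    simp
  push Not at hz
  by_cases hPt : P = ∞
  · rw [hPt, ENNReal.mul_top hC1, ENNReal.top_mul hz.2]
    exact le_top
  by_cases hQt : Q = ∞
  · rw [hQt, ENNReal.mul_top (mul_ne_zero hC1 hz.1)]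
    exact le_top
  refine (hC f g _ _ (P * Q) (fun y z => ?_) (tsum_ite_div_lpNormC_rpow_le hp hr0 hz.1 hPt (P * Q))
    (tsum_ite_div_lpNormC_rpow_le hq hr0 hz.2 hQt (P * Q))).trans ?_
  · rw [← mul_add]
    calc ‖f y‖ₑ * ‖g z‖ₑ = P * Q * (‖f y‖ₑ / P * (‖g z‖ₑ / Q)) := by
          rw [mul_mul_mul_comm, ENNReal.mul_div_cancel hz.1 hPt, ENNReal.mul_div_cancel hz.2 hQt]
      _ ≤ _ := mul_le_mul_right (mul_le_rpow_div_add_rpow_div hp hq hr0 hpqr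
          (div_lpNormC_le_one hp hz.1 hPt y) (div_lpNormC_le_one hq hz.2 hQt z)) _
  · rw [mul_assoc]
    gcongr
    exact le_self_add
end
end

section
/- Let m ≥ 1 and d ≥ 1 be integers with md ≥ 5 (so the lattice point count is regular), and let 1 ≤ p₁, …, p_m, r < ∞. If the m-linear discrete spherical maximal operator T* is bounded from l^{p₁}(ℤ^d) × ⋯ × l^{p_m}(ℤ^d) to l^r(ℤ^d), i.e. there is a constant C such that ‖T*(f₁,…,f_m)‖_{l^r(ℤ^d)} ≤ C ‖f₁‖_{l^{p₁}(ℤ^d)} ⋯ ‖f_m‖_{l^{p_m}(ℤ^d)} for all f₁,…,f_m, then necessarily 1/r ≤ 1/p₁ + ⋯ + 1/p_m. -/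
open scoped ENNReal NNReal BigOperators

noncomputable section

/-- The sphere `{(u₁,…,u_m) ∈ (ℤ^d)^m : |u₁|² + ⋯ + |u_m|² = λ}`. -/
def sphM (m d lam : ℕ) : Set (Fin m → V d) :=
  {u | ∑ j, ∑ i, u j i ^ 2 = (lam : ℤ)}

/-- `N_m(λ)`, the number of lattice points on the sphere of radius `λ^{1/2}` in `ℝ^{md}`. -/
def NcountM (m d lam : ℕ) : ℕ := Nat.card (sphM m d lam)

/-- The `m`-linear discrete spherical average `T_λ(f₁,…,f_m)(x)`. -/
def avgM (m d lam : ℕ) (f : Fin m → V d → ℂ) (x : V d) : ℂ :=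
  (NcountM m d lam : ℂ)⁻¹ *
    ∑' u : sphM m d lam, ∏ j, f j (x - (u : Fin m → V d) j)

/-- The `m`-linear discrete spherical maximal function
`T*(f₁,…,f_m)(x) = sup_{λ ∈ ℕ, N_m(λ)>0} |T_λ(f₁,…,f_m)(x)|`. -/
def maxOpM (m d : ℕ) (f : Fin m → V d → ℂ) (x : V d) : ℝ≥0∞ :=
  ⨆ (lam : ℕ) (_ : 0 < NcountM m d lam), (‖avgM m d lam f x‖₊ : ℝ≥0∞)

/-- The sphere of radius zero is the single point at the origin. -/
theorem sphM_zero (m d : ℕ) : sphM m d 0 = {0} := by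
  ext u
  simp only [sphM, Set.mem_ofPred_eq, Nat.cast_zero, Set.mem_singleton_iff]
  constructor
  · intro h
    rw [Finset.sum_eq_zero_iff_of_nonneg
      (fun j _ => Finset.sum_nonneg fun i _ => sq_nonneg (u j i))] at h
    ext j i
    have hj := (Finset.sum_eq_zero_iff_of_nonneg (fun i _ => sq_nonneg (u j i))).1
      (h j (Finset.mem_univ j))
    exact pow_eq_zero_iff (two_ne_zero) |>.1 (hj i (Finset.mem_univ i))
  · rintro rfl
    simp

/-- There is exactly one lattice point on the sphere of radius zero. -/
theorem NcountM_zero (m d : ℕ) : NcountM m d 0 = 1 := by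
  simp [NcountM, sphM_zero]

/-- The average over the sphere of radius zero is the pointwise product. -/
theorem avgM_zero (m d : ℕ) (f : Fin m → V d → ℂ) (x : V d) :
    avgM m d 0 f x = ∏ j, f j x := by
  rw [avgM, NcountM_zero, tsum_congr_set_coe (fun u : Fin m → V d => ∏ j, f j (x - u j))
    (sphM_zero m d), tsum_singleton (0 : Fin m → V d) (fun u => ∏ j, f j (x - u j))]
  simp

/-- The maximal function dominates the pointwise product. -/
theorem nnnorm_prod_le_maxOpM (m d : ℕ) (f : Fin m → V d → ℂ) (x : V d) :
    (‖∏ j, f j x‖₊ : ℝ≥0∞) ≤ maxOpM m d f x := by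
  rw [← avgM_zero]
  exact le_iSup₂_of_le 0 (by simp [NcountM_zero]) le_rfl

/-- The `l^p` norm of the indicator of a finite set. -/
theorem lpNorm_indicator (d : ℕ) {p : ℝ} (hp : 0 < p) (S : Finset (V d)) :
    lpNorm d p (Set.indicator (S : Set (V d)) 1) = (S.card : ℝ≥0∞) ^ (1 / p) := by
  rw [lpNorm, tsum_eq_sum (s := S)]
  · congr 1
    rw [Finset.sum_congr rfl (g := fun _ => (1 : ℝ≥0∞))]
    · simp
    · intro x hx
      simp [hx]
  · intro x hx
    simp [hx, hp]

/-- The maximal function of indicators of a finite set `S` has `l^r` norm at least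
`|S|^{1/r}`. -/
theorem card_rpow_le_lpNormE_maxOpM (m d : ℕ) {r : ℝ} (hr : 0 < r) (S : Finset (V d)) :
    (S.card : ℝ≥0∞) ^ (1 / r) ≤
      lpNormE d r (maxOpM m d fun _ => Set.indicator (S : Set (V d)) 1) := by
  refine ENNReal.rpow_le_rpow ?_ (by positivity)
  refine le_trans ?_ (ENNReal.sum_le_tsum S)
  rw [Finset.card_eq_sum_ones, Nat.cast_sum]
  refine Finset.sum_le_sum fun x hx => ?_
  have h := nnnorm_prod_le_maxOpM m d (fun _ => Set.indicator (S : Set (V d)) 1) x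
  simp only [Set.indicator_of_mem (Finset.mem_coe.2 hx), Pi.one_apply, Finset.prod_const_one,
    nnnorm_one, ENNReal.coe_one] at h
  simpa using ENNReal.one_le_rpow h hr

/-- Comparison of powers of all positive integers up to a constant forces an inequality
of exponents. -/
theorem le_of_forall_natCast_rpow_le {a b C : ℝ}
    (h : ∀ n : ℕ, 0 < n → (n : ℝ) ^ a ≤ C * (n : ℝ) ^ b) : a ≤ b := by
  by_contra! hab
  have ht : Filter.Tendsto (fun n : ℕ => (n : ℝ) ^ (a - b)) Filter.atTop Filter.atTop :=
    (tendsto_rpow_atTop (sub_pos.2 hab)).comp tendsto_natCast_atTop_atTop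
  obtain ⟨n, hn, hpos⟩ := ((ht.eventually_gt_atTop C).and (Filter.eventually_gt_atTop 0)).exists
  have hn0 : (0 : ℝ) < n := Nat.cast_pos.2 hpos
  rw [Real.rpow_sub hn0, lt_div_iff₀ (Real.rpow_pos_of_pos hn0 b)] at hn
  exact absurd (h n hpos) (not_le.2 hn)

/-- Necessary condition: if the `m`-linear discrete spherical maximal operator
is bounded from `l^{p₁}(ℤ^d) × ⋯ × l^{p_m}(ℤ^d)` to `l^r(ℤ^d)` (with `md ≥ 5` so that the
lattice point count is regular), then `1/r ≤ 1/p₁ + ⋯ + 1/p_m`. -/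
theorem multilinear_discrete_spherical_necessary
    (m d : ℕ) (hm : 1 ≤ m) (hd : 1 ≤ d) (hmd : 5 ≤ m * d)
    (p : Fin m → ℝ) (hp : ∀ j, 1 ≤ p j) (r : ℝ) (hr : 1 ≤ r) (C : ℝ≥0)
    (hbound : ∀ f : Fin m → V d → ℂ,
      lpNormE d r (maxOpM m d f) ≤ C * ∏ j, lpNorm d (p j) (f j)) :
    1 / r ≤ ∑ j, 1 / p j := by
  have : Nonempty (Fin d) := ⟨⟨0, hd⟩⟩
  refine le_of_forall_natCast_rpow_le (C := C) fun n hn => ?_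
  obtain ⟨S, hS⟩ := Infinite.exists_subset_card_eq (V d) n
  have h := (card_rpow_le_lpNormE_maxOpM m d (zero_lt_one.trans_le hr) S).trans (hbound _)
  simp only [fun j => lpNorm_indicator d (zero_lt_one.trans_le (hp j)) S, hS] at h
  have hn0 : (0 : ℝ) < n := Nat.cast_pos.2 hn
  have hcast : ∀ s : ℝ, (n : ℝ≥0∞) ^ s = ENNReal.ofReal ((n : ℝ) ^ s) := fun s => by
    rw [← ENNReal.ofReal_rpow_of_pos hn0, ENNReal.ofReal_natCast]
  simp only [hcast] at h
  rw [← ENNReal.ofReal_prod_of_nonneg (fun j _ => by positivity),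
    ← Real.rpow_sum_of_pos hn0, ← ENNReal.ofReal_coe_nnreal,
    ← ENNReal.ofReal_mul C.coe_nonneg, ENNReal.ofReal_le_ofReal_iff (by positivity)] at h
  exact h
end
end
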